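/- arXiv:1010.1399 — 2 statements merged into one kernel-verified Lean document; each statement's English description precedes it below -/
import Mathlib

section
/- For any fixed real a > -1, Σ_{r ≤ n} p_r^a ~ n p_n^a / (a+1) as n → ∞, where p_n is the n-th prime. -/
open Filter Real Asymptotics

/-- `p n` is the n-th prime, 1-indexed: `p 1 = 2`. -/
noncomputable def p (n : ℕ) : ℕ := Nat.nth Nat.Prime (n - 1)


open MeasureTheory Topology in
theorem pnt_A : ∃ A : ℂ → ℂ, ContinuousOn A {s | 1 ≤ s.re} ∧ ∀ s : ℂ, 1 < s.re →
    LSeries (fun n ↦ ((ArithmeticFunction.vonMangoldt n : ℝ) : ℂ)) s = A s + 1 / (s - 1) := by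
  refine ⟨ArithmeticFunction.vonMangoldt.LFunctionResidueClassAux (q := 1) 1,
    ArithmeticFunction.vonMangoldt.continuousOn_LFunctionResidueClassAux (q := 1) 1, ?_⟩
  intro s hs
  have h := ArithmeticFunction.vonMangoldt.eqOn_LFunctionResidueClassAux (q := 1) (a := 1)
    isUnit_one (x := s) hs
  have h2 : (fun n ↦ ((ArithmeticFunction.vonMangoldt n : ℝ) : ℂ)) =
     fun n ↦ ((ArithmeticFunction.vonMangoldt.residueClass (1 : ZMod 1) n : ℝ) : ℂ) := by
    ext n
    congr 1
    rw [ArithmeticFunction.vonMangoldt.residueClass, Set.indicator_of_mem]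
    exact Subsingleton.elim _ _
  rw [h2, h]
  simp

noncomputable def pntF (u : ℝ) : ℝ := if 0 < u then Chebyshev.psi (exp u) * exp (-u) - 1 else 0

theorem pntF_meas : Measurable pntF := by
  unfold pntF
  refine Measurable.ite measurableSet_Ioi ?_ measurable_const
  have := Chebyshev.psi_mono.measurable
  fun_prop

theorem pntF_bdd (u : ℝ) : |pntF u| ≤ 6 := by
  unfold pntF
  split_ifs with h
  · have h1 := Chebyshev.psi_le_const_mul_self (exp_pos u).le
    have h2 := Chebyshev.psi_nonneg (exp u)
    have h3 : log 4 < 2 := by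
      rw [show (4:ℝ) = 2 ^ 2 by norm_num, Real.log_pow]
      have := Real.log_two_lt_d9
      norm_num; linarith
    have h4 : Chebyshev.psi (exp u) * exp (-u) ≤ log 4 + 4 := by
      rw [exp_neg, ← div_eq_mul_inv, div_le_iff₀ (exp_pos u)]; exact h1
    have h5 : 0 ≤ Chebyshev.psi (exp u) * exp (-u) := by positivity
    rw [abs_le]; constructor <;> linarith
  · simp

open MeasureTheory Topology in
theorem pnt_int_exp (s : ℂ) (hs : 0 < s.re) :
    IntegrableOn (fun u : ℝ ↦ Complex.exp (-s * u)) (Set.Ioi 0) ∧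
    ∫ u in Set.Ioi (0 : ℝ), Complex.exp (-s * u) = 1 / s := by
  constructor
  · exact integrableOn_exp_mul_complex_Ioi (by simpa using hs) 0
  · rw [integral_exp_mul_complex_Ioi (by simpa using hs) 0]
    simp [neg_div]

open MeasureTheory Topology in
theorem pnt_psi_laplace (s : ℂ) (hs : 0 < s.re) :
    LSeries (fun n ↦ ((ArithmeticFunction.vonMangoldt n : ℝ) : ℂ)) (1 + s) = (1 + s) *
      ∫ u in Set.Ioi (0 : ℝ), ((Chebyshev.psi (exp u) * exp (-u) : ℝ) : ℂ) * Complex.exp (-s * u) := by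
  have hpsi (n : ℕ) : ∑ k ∈ Finset.Icc 1 n, ArithmeticFunction.vonMangoldt k
      = Chebyshev.psi n := by
    rw [Chebyshev.psi, Nat.floor_natCast]; rfl
  rw [LSeries_eq_mul_integral_of_nonneg (fun n ↦ ArithmeticFunction.vonMangoldt n) (r := 1)
    zero_le_one (by simpa using hs) _ (fun n ↦ ArithmeticFunction.vonMangoldt_nonneg)]
  · congr 1
    rw [← Real.exp_zero, ← Real.image_exp_Ioi,
      integral_image_eq_integral_abs_deriv_smul measurableSet_Ioi
        (fun x _ ↦ (Real.hasDerivAt_exp x).hasDerivWithinAt) Real.exp_injective.injOn]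
    refine setIntegral_congr_fun measurableSet_Ioi fun u hu ↦ ?_
    rw [← Complex.ofReal_sum, hpsi, ← Chebyshev.psi_eq_psi_coe_floor, abs_of_pos (exp_pos u),
      Complex.cpow_def_of_ne_zero (by simp), ← Complex.ofReal_log (exp_pos u).le, Real.log_exp,
      Complex.real_smul]
    push_cast
    rw [mul_left_comm, ← Complex.exp_add, mul_assoc, ← Complex.exp_add]
    congr 2
    ring
  · simp_rw [hpsi]
    refine IsBigO.of_bound (log 4 + 4) (Eventually.of_forall fun n ↦ ?_)
    have := Chebyshev.psi_le_const_mul_self (Nat.cast_nonneg (α := ℝ) n)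
    rw [Real.norm_of_nonneg (Chebyshev.psi_nonneg _)]
    simpa using this

open MeasureTheory Topology in
theorem pnt_B : ∃ G : ℂ → ℂ, ContinuousOn G {s | 0 ≤ s.re} ∧ ∀ s : ℂ, 0 < s.re →
    ∫ u : ℝ, (pntF u : ℂ) * (Set.Ioi (0:ℝ)).indicator (fun u : ℝ ↦ Complex.exp (-s * u)) u = G s := by
  obtain ⟨A, hA, hAs⟩ := pnt_A
  refine ⟨fun s ↦ (A (1 + s) - 1) / (1 + s), ?_, ?_⟩
  · refine ContinuousOn.div ?_ (by fun_prop) ?_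
    · refine ContinuousOn.sub (hA.comp (by fun_prop) ?_) (by fun_prop)
      intro s hs
      simpa using hs
    · intro s hs h
      have := congrArg Complex.re h
      simp at this hs
      linarith
  · intro s hs
    have h1 := pnt_psi_laplace s hs
    have h2 := pnt_int_exp s hs
    rw [hAs _ (by simpa using hs)] at h1
    have hi : IntegrableOn (fun u : ℝ ↦ (pntF u : ℂ) * Complex.exp (-s * u)) (Set.Ioi 0) := by
      refine h2.1.bdd_mul (c := 6) ?_ ?_
      · have := pntF_meas
        fun_prop
      · filter_upwards with u
        simpa using pntF_bdd u
    have h3 : ∫ u in Set.Ioi (0 : ℝ), ((Chebyshev.psi (exp u) * exp (-u) : ℝ) : ℂ)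
        * Complex.exp (-s * u) = (∫ u in Set.Ioi (0 : ℝ), (pntF u : ℂ) * Complex.exp (-s * u))
          + 1 / s := by
      rw [← h2.2, ← integral_add hi h2.1]
      refine setIntegral_congr_fun measurableSet_Ioi fun u hu ↦ ?_
      have : 0 < u := hu
      simp only [pntF, this, if_true]
      push_cast
      ring
    have h4 : ∫ u : ℝ, (pntF u : ℂ) * (Set.Ioi (0:ℝ)).indicator (fun u : ℝ ↦ Complex.exp (-s * u)) u
       = ∫ u in Set.Ioi (0 : ℝ), (pntF u : ℂ) * Complex.exp (-s * u) := by
      rw [← integral_indicator measurableSet_Ioi]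
      congr 1 with u
      by_cases hu : u ∈ Set.Ioi (0:ℝ) <;> simp [hu]
    rw [h4]
    rw [h3] at h1
    have hs0 : s ≠ 0 := by rintro rfl; simp at hs
    have hs1 : 1 + s ≠ 0 := by
      intro h
      have := congrArg Complex.re h
      simp at this
      linarith
    rw [eq_div_iff hs1]
    have e : (1 + s) * (1 / s) = 1 / s + 1 := by field_simp
    have e2 : 1 + s - 1 = s := by ring
    rw [e2, mul_add, e] at h1
    linear_combination -h1


open MeasureTheory Topology in
theorem pnt_RL (g : ℝ → ℂ) :
    Tendsto (fun v : ℝ ↦ ∫ t : ℝ, Complex.exp (Complex.I * t * v) * g t) atTop (𝓝 0) := by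
  have h := Real.tendsto_integral_exp_smul_cocompact g
  have h2 : Tendsto (fun v : ℝ ↦ (-(2 * π)⁻¹) * v) atTop (cocompact ℝ) := by
    refine Tendsto.mono_right ?_ atBot_le_cocompact
    exact (tendsto_const_mul_atBot_of_neg (by simp; positivity)).2 tendsto_id
  refine (h.comp h2).congr fun v ↦ ?_
  simp only [Function.comp]
  congr 1 with t
  rw [Circle.smul_def, Real.fourierChar_apply, smul_eq_mul]
  congr 2
  have : (π : ℂ) ≠ 0 := by simp [Real.pi_ne_zero]
  push_cast
  field_simp

open MeasureTheory Topology in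
theorem pnt_C (f : ℝ → ℝ) (hf : Measurable f) (B : ℝ) (hB : ∀ u, |f u| ≤ B)
    (hf0 : ∀ u ≤ 0, f u = 0)
    (G : ℂ → ℂ) (hG : ContinuousOn G {s | 0 ≤ s.re})
    (hfG : ∀ s : ℂ, 0 < s.re →
      ∫ u : ℝ, (f u : ℂ) * (Set.Ioi (0:ℝ)).indicator (fun u : ℝ ↦ Complex.exp (-s * u)) u = G s)
    (k : ℝ → ℂ) (hk : Continuous k) (R : ℝ) (hR : ∀ t, R < |t| → k t = 0)
    (K : ℝ → ℂ) (hKc : Measurable K)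
    (hK : ∀ x : ℝ, x ≠ 0 → K x = ∫ t : ℝ, k t * Complex.exp (Complex.I * t * x))
    (hKi : Integrable K) :
    Tendsto (fun v : ℝ ↦ ∫ u : ℝ, (f u : ℂ) * K (v - u)) atTop (𝓝 0) := by
  have hkcs : HasCompactSupport k := by
    refine HasCompactSupport.intro (isCompact_Icc (a := -R) (b := R)) fun t ht ↦ hR t ?_
    rw [lt_abs]
    by_contra! h
    exact ht ⟨by linarith [h.2], h.1⟩
  have hki : Integrable k := hk.integrable_of_hasCompactSupport hkcs
  have hmf : Measurable (fun u ↦ (f u : ℂ)) := by fun_prop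
  -- the indicator exponential
  set E : ℝ → ℝ → ℂ := fun σ ↦ (Set.Ioi (0:ℝ)).indicator (fun u : ℝ ↦ Complex.exp (-(σ:ℂ) * u)) with hE
  have hEm (σ : ℝ) : Measurable (E σ) := by
    refine Measurable.indicator (by fun_prop) measurableSet_Ioi
  have hEi (σ : ℝ) (hσ : 0 < σ) : Integrable (E σ) :=
    (integrable_indicator_iff measurableSet_Ioi).2
      (integrableOn_exp_mul_complex_Ioi (by simpa using hσ) 0)
  have hE1 (σ : ℝ) (hσ : 0 < σ) (u : ℝ) : ‖E σ u‖ ≤ 1 := by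
    simp only [hE]
    by_cases hu : u ∈ Set.Ioi (0:ℝ)
    · rw [Set.indicator_of_mem hu, Complex.norm_exp]
      simp
      have : 0 < u := hu
      positivity
    · simp [Set.indicator_of_notMem hu]
  have hexp1 (x y : ℝ) : ‖Complex.exp (Complex.I * x * y)‖ = 1 := by
    rw [Complex.norm_exp]; simp
  -- step 1
  have key (v σ : ℝ) (hσ : 0 < σ) : ∫ u : ℝ, ((f u : ℂ) * E σ u) * K (v - u) =
      ∫ t : ℝ, Complex.exp (Complex.I * t * v) * (k t * G (σ + Complex.I * t)) := by
    have hfi : Integrable (fun u ↦ (f u : ℂ) * E σ u) := by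
      refine (hEi σ hσ).bdd_mul (c := B) hmf.aestronglyMeasurable ?_
      filter_upwards with u
      simpa using hB u
    have hprod : Integrable (Function.uncurry fun u t : ℝ ↦ ((f u : ℂ) * E σ u) *
        (k t * Complex.exp (Complex.I * t * (v - u : ℝ)))) (volume.prod volume) := by
      have h0 := hfi.mul_prod hki
      refine h0.mono ?_ ?_
      · have := hEm σ
        have := hk.measurable
        refine Measurable.aestronglyMeasurable ?_
        unfold Function.uncurry
        fun_prop
      · filter_upwards with z
        simp only [Function.uncurry, norm_mul, hexp1, mul_one]
        exact le_rfl
    calc ∫ u : ℝ, ((f u : ℂ) * E σ u) * K (v - u)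
        = ∫ u : ℝ, ∫ t : ℝ, ((f u : ℂ) * E σ u) *
            (k t * Complex.exp (Complex.I * t * (v - u : ℝ))) := by
          refine integral_congr_ae ?_
          filter_upwards [compl_mem_ae_iff.2 (measure_singleton v)] with u hu
          have hu' : v - u ≠ 0 := fun h ↦ hu (by simp; linarith)
          rw [hK _ hu', integral_const_mul]
      _ = ∫ t : ℝ, ∫ u : ℝ, ((f u : ℂ) * E σ u) *
            (k t * Complex.exp (Complex.I * t * (v - u : ℝ))) := integral_integral_swap hprod
      _ = _ := by
          congr 1 with t
          rw [← hfG (σ + Complex.I * t) (by simpa using hσ), ← mul_assoc, ← integral_const_mul]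
          congr 1 with u
          simp only [hE]
          by_cases hu : u ∈ Set.Ioi (0:ℝ)
          · simp only [Set.indicator_of_mem hu]
            have : Complex.exp (-(σ:ℂ) * u) * Complex.exp (Complex.I * t * (v - u : ℝ)) =
              Complex.exp (Complex.I * t * v) * Complex.exp (-(σ + Complex.I * t) * u) := by
              rw [← Complex.exp_add, ← Complex.exp_add]
              congr 1
              push_cast; ring
            linear_combination (f u : ℂ) * k t * this
          · simp [Set.indicator_of_notMem hu]
  -- bound for G
  obtain ⟨M, hM⟩ : ∃ M, ∀ σ ∈ Set.Icc (0:ℝ) 1, ∀ t ∈ Set.Icc (-R) R, ‖G (σ + Complex.I * t)‖ ≤ M := by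
    have hc : IsCompact (Set.Icc (0:ℝ) 1 ×ˢ Set.Icc (-R) R) := isCompact_Icc.prod isCompact_Icc
    have hcont : ContinuousOn (fun z : ℝ × ℝ ↦ G (z.1 + Complex.I * z.2))
        (Set.Icc (0:ℝ) 1 ×ˢ Set.Icc (-R) R) := by
      refine hG.comp (by fun_prop) ?_
      rintro ⟨σ, t⟩ ⟨h1, h2⟩
      simpa using h1.1
    obtain ⟨M, hM⟩ := hc.exists_bound_of_continuousOn hcont
    exact ⟨M, fun σ hσ t ht ↦ hM (σ, t) ⟨hσ, ht⟩⟩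
  -- step 2 : limit
  have key2 (v : ℝ) : ∫ u : ℝ, (f u : ℂ) * K (v - u) =
      ∫ t : ℝ, Complex.exp (Complex.I * t * v) * (k t * G (Complex.I * t)) := by
    have hpos : ∀ᶠ σ : ℝ in 𝓝[>] 0, 0 < σ := eventually_mem_nhdsWithin
    have hle : ∀ᶠ σ : ℝ in 𝓝[>] 0, σ < 1 :=
      mem_nhdsWithin_of_mem_nhds (Iio_mem_nhds one_pos)
    have L1 : Tendsto (fun σ : ℝ ↦ ∫ u : ℝ, ((f u : ℂ) * E σ u) * K (v - u)) (𝓝[>] 0)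
        (𝓝 (∫ u : ℝ, (f u : ℂ) * K (v - u))) := by
      refine tendsto_integral_filter_of_dominated_convergence (fun u ↦ B * ‖K (v - u)‖) ?_ ?_ ?_ ?_
      · filter_upwards with σ
        have := hEm σ
        exact Measurable.aestronglyMeasurable (by fun_prop)
      · filter_upwards [hpos] with σ hσ
        filter_upwards with u
        rw [norm_mul, norm_mul]
        have h1 := hE1 σ hσ u
        have h2 : ‖(f u : ℂ)‖ ≤ B := by simpa using hB u
        have : ‖(f u : ℂ)‖ * ‖E σ u‖ ≤ B * 1 := by gcongr; exact (norm_nonneg _).trans h2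
        rw [mul_one] at this
        gcongr
      · exact (hKi.comp_sub_left v).norm.const_mul B
      · filter_upwards with u
        refine Tendsto.mul_const _ ?_
        by_cases hu : u ∈ Set.Ioi (0:ℝ)
        · simp only [hE, Set.indicator_of_mem hu]
          have : Tendsto (fun σ : ℝ ↦ (f u : ℂ) * Complex.exp (-(σ:ℂ) * u)) (𝓝 0)
              (𝓝 ((f u : ℂ) * Complex.exp (-((0:ℝ):ℂ) * u))) :=
            Continuous.tendsto (by fun_prop) 0
          simpa using this.mono_left nhdsWithin_le_nhds
        · have : f u = 0 := hf0 u (by simpa using hu)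
          simp [this]
    have L2 : Tendsto (fun σ : ℝ ↦ ∫ t : ℝ, Complex.exp (Complex.I * t * v) *
        (k t * G (σ + Complex.I * t))) (𝓝[>] 0)
        (𝓝 (∫ t : ℝ, Complex.exp (Complex.I * t * v) * (k t * G (Complex.I * t)))) := by
      refine tendsto_integral_filter_of_dominated_convergence (fun t ↦ ‖k t‖ * M) ?_ ?_ ?_ ?_
      · filter_upwards [hpos] with σ hσ
        refine Continuous.aestronglyMeasurable ?_
        have : Continuous fun t : ℝ ↦ G (σ + Complex.I * t) := by
          refine hG.comp_continuous (by fun_prop) ?_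
          intro t
          simpa using hσ.le
        exact (by fun_prop : Continuous fun t : ℝ ↦ Complex.exp (Complex.I * t * v)).mul
          (hk.mul this)
      · filter_upwards [hpos, hle] with σ hσ hσ1
        filter_upwards with t
        rw [norm_mul, hexp1, one_mul, norm_mul]
        by_cases ht : R < |t|
        · simp [hR t ht]
        · have := hM σ ⟨hσ.le, hσ1.le⟩ t (abs_le.1 (not_lt.1 ht))
          gcongr
      · exact hki.norm.mul_const M
      · filter_upwards with t
        refine Tendsto.const_mul _ (Tendsto.const_mul _ ?_)
        have hc : ContinuousWithinAt (fun σ : ℝ ↦ G (σ + Complex.I * t)) (Set.Ici 0) 0 := by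
          have : ContinuousOn (fun σ : ℝ ↦ G (σ + Complex.I * t)) (Set.Ici 0) := by
            refine hG.comp (by fun_prop) ?_
            intro σ hσ
            simpa using hσ
          exact this 0 (by simp)
        have := hc.tendsto.mono_left (nhdsWithin_mono 0 Set.Ioi_subset_Ici_self)
        simpa using this
    refine tendsto_nhds_unique (L1.congr' ?_) L2
    filter_upwards [hpos] with σ hσ using key v σ hσ
  simp_rw [key2]
  exact pnt_RL _


noncomputable def pntK (x : ℝ) : ℝ := 2 * (1 - cos x) / x ^ 2

noncomputable def pntk (t : ℝ) : ℂ := ((max 0 (1 - |t|) : ℝ) : ℂ)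

theorem pntk_cont : Continuous pntk := by
  unfold pntk; fun_prop

theorem pntk_zero (t : ℝ) (ht : 1 ≤ |t|) : pntk t = 0 := by
  unfold pntk
  rw [max_eq_left (by linarith)]; simp

theorem pntK_nonneg (x : ℝ) : 0 ≤ pntK x := by
  unfold pntK
  have := cos_le_one x
  have : 0 ≤ 1 - cos x := by linarith
  positivity

theorem pntK_meas : Measurable pntK := by
  unfold pntK; fun_prop

open MeasureTheory Topology in
theorem pntK_integrable : Integrable pntK := by
  refine (integrable_inv_one_add_sq.const_mul 5).mono' pntK_meas.aestronglyMeasurable ?_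
  filter_upwards with x
  rw [Real.norm_of_nonneg (pntK_nonneg x), ← div_eq_mul_inv, le_div_iff₀ (by positivity)]
  unfold pntK
  rcases eq_or_ne x 0 with rfl | hx
  · simp
  · have h1 := Real.one_sub_sq_div_two_le_cos (x := x)
    have h2 := neg_one_le_cos x
    have hx2 : 0 < x ^ 2 := by positivity
    have h3 : 2 * (1 - cos x) / x ^ 2 ≤ 1 := by
      rw [div_le_one hx2]; linarith
    have h4 : 2 * (1 - cos x) / x ^ 2 * x ^ 2 = 2 * (1 - cos x) := by field_simp
    nlinarith

open MeasureTheory Topology in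
theorem pntK_pos : 0 < ∫ x, pntK x := by
  rw [integral_pos_iff_support_of_nonneg pntK_nonneg pntK_integrable]
  refine lt_of_lt_of_le ?_ (measure_mono (s := Set.Ioo 0 1) ?_)
  · simp
  · rintro x ⟨h0, h1⟩
    have h3 : cos x < 1 := by
      have := Real.cos_lt_cos_of_nonneg_of_le_pi (x := 0) (y := x) le_rfl
        (by linarith [Real.pi_gt_three]) h0
      simpa using this
    have : 0 < 1 - cos x := by linarith
    have : 0 < pntK x := by unfold pntK; positivity
    exact this.ne'

open MeasureTheory Topology in
theorem pntK_eq (x : ℝ) (hx : x ≠ 0) :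
    ∫ t : ℝ, pntk t * Complex.exp (Complex.I * t * x) = pntK x := by
  have hc : Continuous fun t : ℝ ↦ pntk t * Complex.exp (Complex.I * t * x) := by
    have := pntk_cont
    fun_prop
  have h1 : ∫ t : ℝ, pntk t * Complex.exp (Complex.I * t * x) =
      ∫ t in (-1 : ℝ)..1, pntk t * Complex.exp (Complex.I * t * x) := by
    rw [intervalIntegral.integral_of_le (by norm_num)]
    symm
    refine setIntegral_eq_integral_of_forall_compl_eq_zero fun t ht ↦ ?_
    rw [pntk_zero, zero_mul]
    rw [Set.mem_Ioc, not_and_or] at ht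
    rw [le_abs]
    rcases ht with h | h
    · right; linarith
    · left; linarith
  rw [h1, ← intervalIntegral.integral_add_adjacent_intervals (b := 0)
    (hc.intervalIntegrable _ _) (hc.intervalIntegrable _ _)]
  set c : ℂ := Complex.I * x with hcdef
  have hc0 : c ≠ 0 := by simp [hcdef, hx]
  have hd (t : ℝ) : HasDerivAt (fun t : ℝ ↦ Complex.exp (c * t)) (Complex.exp (c * t) * c) t := by
    have := ((hasDerivAt_id (t : ℂ)).const_mul c).cexp.comp_ofReal
    simpa using this
  have hid (t : ℝ) : HasDerivAt (fun t : ℝ ↦ (t : ℂ)) 1 t := (hasDerivAt_id (t:ℂ)).comp_ofReal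
  have e1 : ∫ t in (0 : ℝ)..1, pntk t * Complex.exp (Complex.I * t * x) =
      Complex.exp c / c ^ 2 - 1 / c - 1 / c ^ 2 := by
    have : ∫ t in (0 : ℝ)..1, pntk t * Complex.exp (Complex.I * t * x) =
        ∫ t in (0 : ℝ)..1, (1 - (t:ℂ)) * Complex.exp (c * t) := by
      refine intervalIntegral.integral_congr fun t ht ↦ ?_
      rw [Set.uIcc_of_le zero_le_one] at ht
      simp only [pntk]
      rw [abs_of_nonneg ht.1, max_eq_right (by linarith [ht.2])]
      push_cast
      congr 2
      simp only [hcdef]; ring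
    rw [this, intervalIntegral.integral_eq_sub_of_hasDerivAt
      (f := fun t : ℝ ↦ (1 - (t:ℂ)) * Complex.exp (c * t) / c + Complex.exp (c * t) / c ^ 2)]
    · simp; ring
    · intro t _
      have := (((hid t).const_sub 1).mul (hd t)).div_const c |>.add ((hd t).div_const (c ^ 2))
      refine this.congr_deriv ?_
      field_simp
      ring
    · exact Continuous.intervalIntegrable (by fun_prop) _ _
  have e2 : ∫ t in (-1 : ℝ)..0, pntk t * Complex.exp (Complex.I * t * x) =
      1 / c - 1 / c ^ 2 + Complex.exp (-c) / c ^ 2 := by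
    have : ∫ t in (-1 : ℝ)..0, pntk t * Complex.exp (Complex.I * t * x) =
        ∫ t in (-1 : ℝ)..0, (1 + (t:ℂ)) * Complex.exp (c * t) := by
      refine intervalIntegral.integral_congr fun t ht ↦ ?_
      rw [Set.uIcc_of_le (by norm_num)] at ht
      simp only [pntk]
      rw [abs_of_nonpos ht.2, max_eq_right (by linarith [ht.1])]
      push_cast
      congr 2
      · ring
      · simp only [hcdef]; ring
    rw [this, intervalIntegral.integral_eq_sub_of_hasDerivAt
      (f := fun t : ℝ ↦ (1 + (t:ℂ)) * Complex.exp (c * t) / c - Complex.exp (c * t) / c ^ 2)]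
    · simp
    · intro t _
      have := (((hid t).const_add 1).mul (hd t)).div_const c |>.sub ((hd t).div_const (c ^ 2))
      refine this.congr_deriv ?_
      field_simp
      ring
    · exact Continuous.intervalIntegrable (by fun_prop) _ _
  rw [e1, e2]
  have hcos : Complex.exp c + Complex.exp (-c) = 2 * Complex.cos x := by
    rw [Complex.cos, hcdef, mul_comm Complex.I]
    ring_nf
  have hc2 : c ^ 2 = - (x:ℂ) ^ 2 := by rw [hcdef, mul_pow, Complex.I_sq]; ring
  have hx' : (x : ℂ) ≠ 0 := by simpa using hx
  unfold pntK
  push_cast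
  have : 1 / c - 1 / c ^ 2 + Complex.exp (-c) / c ^ 2 + (Complex.exp c / c ^ 2 - 1 / c - 1 / c ^ 2)
     = (Complex.exp c + Complex.exp (-c) - 2) / c ^ 2 := by ring
  rw [this, hcos, hc2]
  field_simp
  ring

open MeasureTheory Topology in
theorem pnt_conv (l : ℝ) (hl : 0 < l) :
    Tendsto (fun v : ℝ ↦ ∫ y : ℝ, pntF (v - y / l) * pntK y) atTop (𝓝 0) := by
  obtain ⟨G, hG, hGs⟩ := pnt_B
  have h := pnt_C pntF pntF_meas 6 pntF_bdd (fun u hu ↦ by simp [pntF, not_lt.2 hu]) G hG hGs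
    (fun t ↦ pntk (t / l)) (pntk_cont.comp (by fun_prop)) l
    (fun t ht ↦ pntk_zero _ (by
      rw [abs_div, abs_of_pos hl, le_div_iff₀ hl]; linarith))
    (fun x ↦ ((l * pntK (l * x) : ℝ) : ℂ))
    (by have := pntK_meas; fun_prop)
    (by
      intro x hx
      have h1 := pntK_eq (l * x) (by positivity)
      have h2 := Measure.integral_comp_div
        (fun t : ℝ ↦ pntk t * Complex.exp (Complex.I * t * (l * x : ℝ))) l
      rw [h1, abs_of_pos hl] at h2
      rw [Complex.ofReal_mul, ← Complex.real_smul, ← h2]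
      congr 1 with t
      congr 2
      have : (l : ℂ) ≠ 0 := by simpa using hl.ne'
      push_cast
      field_simp)
    (((pntK_integrable.comp_mul_left' hl.ne').const_mul l).ofReal)
  have h2 : Tendsto (fun v : ℝ ↦ ∫ u : ℝ, pntF u * (l * pntK (l * (v - u)))) atTop (𝓝 0) := by
    have h3 := (Complex.continuous_re.tendsto 0).comp h
    simp only [Complex.zero_re] at h3
    refine h3.congr fun v ↦ ?_
    simp only [Function.comp]
    rw [← Complex.ofReal_re (∫ u : ℝ, pntF u * (l * pntK (l * (v - u)))), ← integral_complex_ofReal]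
    simp
  refine h2.congr fun v ↦ ?_
  have e1 := integral_sub_left_eq_self (fun u ↦ pntF u * (l * pntK (l * (v - u)))) volume v
  rw [← e1]
  have e2 := Measure.integral_comp_mul_left (fun y ↦ pntF (v - y / l) * pntK y) l
  rw [abs_of_pos (by positivity : 0 < l⁻¹), smul_eq_mul] at e2
  rw [eq_comm, ← mul_right_inj' (by positivity : l⁻¹ ≠ 0), ← e2, ← integral_const_mul]
  congr 1 with y
  rw [mul_div_cancel_left₀ _ hl.ne', sub_sub_cancel]
  field_simp

open MeasureTheory Topology in
theorem pnt_plateau (ε δ : ℝ) (hε : 0 < ε) (hδ : 0 < δ) (w : ℝ) (hw : w = 1 ∨ w = -1) :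
    ∀ᶠ v in atTop, ∃ u ∈ Set.Icc (v - δ) (v + δ), w * pntF u < ε := by
  -- step functions
  set m : ℝ → ℝ → ℝ := fun M y ↦ if |y| ≤ M then ε else -6 with hm
  have hmm (M : ℝ) : Measurable (m M) :=
    Measurable.ite (measurableSet_le (by fun_prop) measurable_const) measurable_const measurable_const
  have hmb (M y : ℝ) : ‖m M y‖ ≤ ε + 6 := by
    simp only [hm]
    split_ifs
    · rw [Real.norm_of_nonneg hε.le]; linarith
    · norm_num; linarith
  have hKm := pntK_meas
  have L : Tendsto (fun M : ℝ ↦ ∫ y, m M y * pntK y) atTop (𝓝 (∫ y, ε * pntK y)) := by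
    refine tendsto_integral_filter_of_dominated_convergence (fun y ↦ (ε + 6) * pntK y) ?_ ?_ ?_ ?_
    · filter_upwards with M
      have := hmm M
      exact Measurable.aestronglyMeasurable (by fun_prop)
    · filter_upwards with M
      filter_upwards with y
      rw [norm_mul, Real.norm_of_nonneg (pntK_nonneg y)]
      exact mul_le_mul_of_nonneg_right (hmb M y) (pntK_nonneg y)
    · exact pntK_integrable.const_mul _
    · filter_upwards with y
      refine tendsto_const_nhds.congr' ?_
      filter_upwards [eventually_ge_atTop |y|] with M hM
      simp [hm, hM]
  rw [integral_const_mul] at L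
  have hpos : 0 < ε * ∫ y, pntK y := mul_pos hε pntK_pos
  obtain ⟨M, hM1, hM0⟩ := ((L.eventually (lt_mem_nhds hpos)).and (eventually_gt_atTop 0)).exists
  have hl : 0 < M / δ := by positivity
  have hc := (pnt_conv (M / δ) hl).const_mul w
  rw [mul_zero] at hc
  filter_upwards [hc.eventually (gt_mem_nhds hM1)] with v hv
  by_contra! hcon
  refine absurd hv (not_lt.2 ?_)
  rw [← integral_const_mul]
  have hw1 : |w| = 1 := by rcases hw with rfl | rfl <;> simp
  have hb (u : ℝ) : |w * pntF u| ≤ 6 := by rw [abs_mul, hw1, one_mul]; exact pntF_bdd u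
  have hFm := pntF_meas
  have hmM := hmm M
  refine integral_mono ?_ ?_ ?_
  · exact pntK_integrable.bdd_mul (c := ε + 6) hmM.aestronglyMeasurable
      (Eventually.of_forall fun y ↦ hmb M y)
  · have := pntK_integrable.bdd_mul (c := 6) (f := fun y ↦ w * pntF (v - y / (M / δ)))
      (Measurable.aestronglyMeasurable (by fun_prop)) (Eventually.of_forall fun y ↦ hb _)
    refine this.congr (Eventually.of_forall fun y ↦ ?_)
    simp only []
    ring
  · intro y
    simp only
    rw [← mul_assoc]
    refine mul_le_mul_of_nonneg_right ?_ (pntK_nonneg y)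
    simp only [hm]
    split_ifs with hy
    · apply hcon
      have h1 : |y / (M / δ)| ≤ δ := by
        rw [abs_div, abs_of_pos hl, div_le_iff₀ hl]
        have : δ * (M / δ) = M := by field_simp
        rw [this]; exact hy
      rw [abs_le] at h1
      constructor <;> linarith [h1.1, h1.2]
    · exact (abs_le.1 (hb _)).1

open MeasureTheory Topology in
theorem pntF_tendsto : Tendsto pntF atTop (𝓝 0) := by
  -- monotonicity consequence
  have mono (u h : ℝ) (hu : 0 < u) (hh : 0 ≤ h) : pntF u + 1 ≤ (pntF (u + h) + 1) * exp h := by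
    have hu' : 0 < u + h := by linarith
    simp only [pntF, hu, hu', if_true, sub_add_cancel]
    rw [mul_assoc, ← exp_add, show -(u + h) + h = -u by ring]
    gcongr
    linarith
  suffices H : ∀ ε : ℝ, 0 < ε → ε ≤ 1 → ∀ᶠ v in atTop, |pntF v| < ε by
    rw [Metric.tendsto_nhds]
    intro ε hε
    filter_upwards [H (min ε 1) (by positivity) (min_le_right _ _)] with v hv
    simpa using hv.trans_le (min_le_left _ _)
  intro ε hε hε1
  set δ := log (1 + ε / 4) / 2 with hδ
  have hlog : 0 < log (1 + ε / 4) := Real.log_pos (by linarith)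
  have hδ0 : 0 < δ := by positivity
  have hexp : exp (2 * δ) = 1 + ε / 4 := by
    rw [hδ, mul_div_cancel₀ _ two_ne_zero, Real.exp_log (by linarith)]
  have P1 := pnt_plateau (ε / 2) δ (by linarith) hδ0 1 (Or.inl rfl)
  have P2 := pnt_plateau (ε / 2) δ (by linarith) hδ0 (-1) (Or.inr rfl)
  have s1 : Tendsto (fun v : ℝ ↦ v + δ) atTop atTop := tendsto_atTop_add_const_right _ _ tendsto_id
  have s2 : Tendsto (fun v : ℝ ↦ v - δ) atTop atTop := tendsto_atTop_add_const_right _ _ tendsto_id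
  filter_upwards [s1.eventually P1, s2.eventually P2, eventually_gt_atTop (2 * δ)]
    with v h1 h2 hv
  obtain ⟨u, ⟨hu1, hu2⟩, hu⟩ := h1
  obtain ⟨u', ⟨hu1', hu2'⟩, hu'⟩ := h2
  rw [abs_lt]
  have fge (u : ℝ) : 0 ≤ pntF u + 1 := by
    unfold pntF
    split_ifs
    · have := Chebyshev.psi_nonneg (exp u)
      have := exp_pos (-u)
      rw [sub_add_cancel]; positivity
    · norm_num
  constructor
  · -- lower
    have m := mono u' (v - u') (by linarith) (by linarith)
    rw [show u' + (v - u') = v by ring] at m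
    have e : exp (v - u') ≤ 1 + ε / 4 := by rw [← hexp]; exact exp_le_exp.2 (by linarith)
    have := mul_le_mul_of_nonneg_left e (fge v)
    by_contra! hcon
    nlinarith
  · have m := mono v (u - v) (by linarith) (by linarith)
    rw [show v + (u - v) = u by ring] at m
    have e : exp (u - v) ≤ 1 + ε / 4 := by rw [← hexp]; exact exp_le_exp.2 (by linarith)
    have := mul_le_mul_of_nonneg_left e (fge u)
    by_contra! hcon
    nlinarith

open MeasureTheory Topology in
theorem pnt_psi : Tendsto (fun x : ℝ ↦ Chebyshev.psi x / x) atTop (𝓝 1) := by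
  have h := (pntF_tendsto.comp Real.tendsto_log_atTop).add_const 1
  rw [zero_add] at h
  refine h.congr' ?_
  filter_upwards [eventually_gt_atTop 1] with x hx
  simp only [Function.comp, pntF, Real.log_pos hx, if_true]
  rw [Real.exp_neg, Real.exp_log (by linarith), sub_add_cancel, div_eq_mul_inv]

open Topology in
theorem pnt_theta : Tendsto (fun x : ℝ ↦ Chebyshev.theta x / x) atTop (𝓝 1) := by
  have h1 : Tendsto (fun x : ℝ ↦ (Chebyshev.psi x - Chebyshev.theta x) / x) atTop (𝓝 0) := by
    have hO := Chebyshev.isBigO_psi_sub_theta_sqrt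
    have ho : (fun x : ℝ ↦ √x) =o[atTop] (fun x : ℝ ↦ x) := by
      refine isLittleO_iff_tendsto' ?_ |>.mpr ?_
      · filter_upwards [eventually_gt_atTop 0] with x hx h
        exact absurd h hx.ne'
      · refine Tendsto.congr' (f₁ := fun x ↦ (√x)⁻¹) ?_
          Real.tendsto_sqrt_atTop.inv_tendsto_atTop
        filter_upwards with x
        rw [Real.sqrt_div_self]
    exact (hO.trans_isLittleO ho).tendsto_div_nhds_zero
  have := pnt_psi.sub h1
  rw [sub_zero] at this
  refine this.congr fun x ↦ ?_
  ring

open Topology in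
theorem pnt_pi : Tendsto (fun x : ℝ ↦ (Nat.primeCounting ⌊x⌋₊ : ℝ) * log x / x) atTop (𝓝 1) := by
  have hO := Chebyshev.primeCounting_sub_theta_div_log_isBigO
  have ho : (fun x : ℝ ↦ x / log x ^ 2) =o[atTop] (fun x : ℝ ↦ x / log x) := by
    refine isLittleO_iff_tendsto' ?_ |>.mpr ?_
    · filter_upwards [eventually_gt_atTop 1] with x hx h
      have := Real.log_pos hx
      have : 0 < x / log x := by positivity
      exact absurd h this.ne'
    · refine Tendsto.congr' (f₁ := fun x ↦ (log x)⁻¹) ?_ tendsto_log_atTop.inv_tendsto_atTop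
      filter_upwards [eventually_gt_atTop 1] with x hx
      have := Real.log_pos hx
      field_simp
  have h := ((hO.trans_isLittleO ho).tendsto_div_nhds_zero).add pnt_theta
  rw [zero_add] at h
  refine h.congr' ?_
  filter_upwards [eventually_gt_atTop 1] with x hx
  have := Real.log_pos hx
  field_simp
  ring

theorem pnt_count (n : ℕ) : Nat.primeCounting (p (n + 1)) = n + 1 := by
  rw [p, Nat.add_sub_cancel, Nat.primeCounting, Nat.primeCounting',
    Nat.count_nth_succ_of_infinite Nat.infinite_setOfPred_prime]

open Topology in
theorem pnt_p_atTop : Tendsto (fun n : ℕ ↦ (p (n + 1) : ℝ)) atTop atTop := by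
  refine tendsto_natCast_atTop_atTop.comp ?_
  simp only [p, Nat.add_sub_cancel]
  exact (Nat.nth_strictMono Nat.infinite_setOfPred_prime).tendsto_atTop

open Topology in
theorem pnt_p : Tendsto (fun n : ℕ ↦ ((n + 1 : ℕ) : ℝ) * log ((n + 1 : ℕ) : ℝ) / (p (n + 1) : ℝ))
    atTop (𝓝 1) := by
  have h1 : Tendsto (fun n : ℕ ↦ ((n + 1 : ℕ) : ℝ) * log (p (n + 1)) / (p (n + 1) : ℝ))
      atTop (𝓝 1) := by
    refine (pnt_pi.comp pnt_p_atTop).congr fun n ↦ ?_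
    simp only [Function.comp, Nat.floor_natCast, pnt_count]
  have hlogp : Tendsto (fun n : ℕ ↦ log (p (n + 1))) atTop atTop :=
    tendsto_log_atTop.comp pnt_p_atTop
  have h2 : Tendsto (fun n : ℕ ↦ log (((n + 1 : ℕ) : ℝ) * log (p (n + 1)) / (p (n + 1) : ℝ)))
      atTop (𝓝 0) := by
    have := (Real.continuousAt_log one_ne_zero).tendsto.comp h1
    simpa [Function.comp_def] using this
  have h3 : Tendsto (fun n : ℕ ↦ log (log (p (n + 1))) / log (p (n + 1))) atTop (𝓝 0) :=
    (Real.isLittleO_log_id_atTop.tendsto_div_nhds_zero).comp hlogp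
  have h4 : Tendsto (fun n : ℕ ↦ log ((n + 1 : ℕ) : ℝ) / log (p (n + 1))) atTop (𝓝 1) := by
    have := ((h2.div_atTop hlogp).sub h3).add_const 1
    rw [sub_zero, zero_add] at this
    refine this.congr' ?_
    filter_upwards [hlogp.eventually_gt_atTop 0, pnt_p_atTop.eventually_gt_atTop 0] with n hn hn'
    have h0 : (0:ℝ) < ((n + 1 : ℕ) : ℝ) := by positivity
    rw [Real.log_div (by positivity) hn'.ne', Real.log_mul h0.ne' hn.ne']
    field_simp
    ring
  have := h1.mul h4
  rw [one_mul] at this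
  refine this.congr' ?_
  filter_upwards [hlogp.eventually_gt_atTop 0] with n hn
  field_simp

noncomputable def pntc (a x : ℝ) : ℝ := x ^ (a + 1) * log x ^ a / (a + 1)

theorem pntc_deriv (a x : ℝ) (ha : -1 < a) (hx : 1 < x) :
    HasDerivAt (pntc a) ((x * log x) ^ a * (1 + a / (a + 1) / log x)) x := by
  have hl := Real.log_pos hx
  have hx0 : 0 < x := by linarith
  have ha1 : a + 1 ≠ 0 := by linarith
  have h1 : HasDerivAt (fun x : ℝ ↦ x ^ (a + 1)) ((a + 1) * x ^ a) x := by
    simpa using Real.hasDerivAt_rpow_const (x := x) (p := a + 1) (Or.inl hx0.ne')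
  have h2 : HasDerivAt (fun x : ℝ ↦ log x ^ a) (x⁻¹ * a * log x ^ (a - 1)) x :=
    (Real.hasDerivAt_log hx0.ne').rpow_const (Or.inl hl.ne')
  refine ((h1.mul h2).div_const (a + 1)).congr_deriv ?_
  rw [Real.mul_rpow hx0.le hl.le, Real.rpow_sub_one hl.ne', Real.rpow_add_one hx0.ne']
  field_simp

open Topology in
theorem pntc_diff (a : ℝ) (ha : -1 < a) :
    Tendsto (fun i : ℕ ↦ (pntc a ((i + 1 : ℕ) : ℝ) - pntc a i) / (p (i + 1) : ℝ) ^ a)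
      atTop (𝓝 1) := by
  have hex (i : ℕ) : ∃ ξ : ℝ, 2 ≤ i → ((i : ℝ) < ξ ∧ ξ < i + 1 ∧
      pntc a ((i + 1 : ℕ) : ℝ) - pntc a i = (ξ * log ξ) ^ a * (1 + a / (a + 1) / log ξ)) := by
    by_cases hi : 2 ≤ i
    · have hi' : (2 : ℝ) ≤ i := by exact_mod_cast hi
      obtain ⟨ξ, ⟨h1, h2⟩, h3⟩ := exists_hasDerivAt_eq_slope (pntc a)
        (fun x ↦ (x * log x) ^ a * (1 + a / (a + 1) / log x)) (show (i : ℝ) < i + 1 by linarith)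
        (fun x hx ↦ (pntc_deriv a x ha (by linarith [hx.1])).continuousAt.continuousWithinAt)
        (fun x hx ↦ pntc_deriv a x ha (by linarith [hx.1]))
      refine ⟨ξ, fun _ ↦ ⟨h1, h2, ?_⟩⟩
      rw [h3]
      push_cast
      rw [add_sub_cancel_left, div_one]
    · exact ⟨0, fun h ↦ absurd h hi⟩
  choose ξ hξ using hex
  have hcast : Tendsto (fun i : ℕ ↦ (i : ℝ)) atTop atTop := tendsto_natCast_atTop_atTop
  have hξt : Tendsto ξ atTop atTop := by
    refine tendsto_atTop_mono' _ ?_ hcast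
    filter_upwards [eventually_ge_atTop 2] with i hi using (hξ i hi).1.le
  have hlog : Tendsto (fun i ↦ log (ξ i)) atTop atTop := tendsto_log_atTop.comp hξt
  have hcast1 : Tendsto (fun i : ℕ ↦ ((i + 1 : ℕ) : ℝ)) atTop atTop :=
    hcast.comp (tendsto_add_atTop_nat 1)
  have hlogi : Tendsto (fun i : ℕ ↦ log ((i + 1 : ℕ) : ℝ)) atTop atTop :=
    tendsto_log_atTop.comp hcast1
  -- ξ log ξ / ((i+1) log (i+1)) → 1
  have r1 : Tendsto (fun i : ℕ ↦ ξ i * log (ξ i) / (((i + 1 : ℕ) : ℝ) * log ((i + 1 : ℕ) : ℝ)))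
      atTop (𝓝 1) := by
    have low : Tendsto (fun i : ℕ ↦ 1 - (((i + 1 : ℕ) : ℝ))⁻¹ -
        (((i + 1 : ℕ) : ℝ) * log ((i + 1 : ℕ) : ℝ))⁻¹) atTop (𝓝 1) := by
      have := (hcast1.inv_tendsto_atTop.const_sub 1).sub
        (hcast1.atTop_mul_atTop₀ hlogi).inv_tendsto_atTop
      simpa using this
    refine tendsto_of_tendsto_of_tendsto_of_le_of_le' low tendsto_const_nhds ?_ ?_
    · filter_upwards [eventually_ge_atTop 2] with i hi
      obtain ⟨h1, h2, -⟩ := hξ i hi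
      have hi' : (2 : ℝ) ≤ i := by exact_mod_cast hi
      have hl : 0 < log ((i + 1 : ℕ) : ℝ) := Real.log_pos (by push_cast; linarith)
      have hp : 0 < ((i + 1 : ℕ) : ℝ) := by positivity
      rw [le_div_iff₀ (by positivity)]
      have e : (1 - (((i + 1 : ℕ) : ℝ))⁻¹ - (((i + 1 : ℕ) : ℝ) * log ((i + 1 : ℕ) : ℝ))⁻¹) *
        (((i + 1 : ℕ) : ℝ) * log ((i + 1 : ℕ) : ℝ)) = (i : ℝ) * log ((i + 1 : ℕ) : ℝ) - 1 := by
        field_simp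
        push_cast
        ring
      rw [e]
      have h3 : (i : ℝ) * log i ≤ ξ i * log (ξ i) := by
        have := Real.log_nonneg (by linarith : (1:ℝ) ≤ i)
        have := Real.log_le_log (by linarith) h1.le
        have hξ0 : 0 ≤ ξ i := by linarith
        exact mul_le_mul h1.le this (by assumption) hξ0
      have h4 : log ((i + 1 : ℕ) : ℝ) ≤ log i + 1 / i := by
        have h5 := Real.log_le_sub_one_of_pos (x := ((i + 1 : ℕ) : ℝ) / i) (by positivity)
        rw [Real.log_div (by positivity) (by positivity)] at h5
        have : ((i + 1 : ℕ) : ℝ) / i - 1 = 1 / i := by push_cast; field_simp; ring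
        linarith
      have h6 : (i : ℝ) * log ((i + 1 : ℕ) : ℝ) ≤ i * (log i + 1 / i) := by gcongr
      have h7 : (i : ℝ) * (log i + 1 / i) = i * log i + 1 := by field_simp
      linarith
    · filter_upwards [eventually_ge_atTop 2] with i hi
      obtain ⟨h1, h2, -⟩ := hξ i hi
      have hi' : (2 : ℝ) ≤ i := by exact_mod_cast hi
      have hl : 0 < log ((i + 1 : ℕ) : ℝ) := Real.log_pos (by push_cast; linarith)
      have hp : 0 < ((i + 1 : ℕ) : ℝ) := by positivity
      have h2' : ξ i ≤ ((i + 1 : ℕ) : ℝ) := by push_cast; exact h2.le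
      rw [div_le_one (by positivity)]
      have := Real.log_nonneg (by linarith : (1:ℝ) ≤ ξ i)
      have := Real.log_le_log (by linarith) h2'
      gcongr
  have r2 := r1.mul pnt_p
  rw [one_mul] at r2
  have r3 := (r2.rpow_const (p := a) (Or.inl one_ne_zero)).mul
    ((hlog.const_div_atTop (a / (a + 1))).const_add 1)
  rw [Real.one_rpow, one_mul, add_zero] at r3
  refine r3.congr' ?_
  filter_upwards [eventually_ge_atTop 2, pnt_p_atTop.eventually_gt_atTop 0] with i hi hp0
  obtain ⟨h1, h2, h3⟩ := hξ i hi
  have hi' : (2 : ℝ) ≤ i := by exact_mod_cast hi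
  have hl : 0 < log ((i + 1 : ℕ) : ℝ) := Real.log_pos (by push_cast; linarith)
  have hp : 0 < ((i + 1 : ℕ) : ℝ) := by positivity
  have := Real.log_nonneg (by linarith : (1:ℝ) ≤ ξ i)
  have hξ0 : 0 ≤ ξ i := by linarith
  have e : ξ i * log (ξ i) / (((i + 1 : ℕ) : ℝ) * log ((i + 1 : ℕ) : ℝ)) *
      (((i + 1 : ℕ) : ℝ) * log ((i + 1 : ℕ) : ℝ) / (p (i + 1) : ℝ)) =
      ξ i * log (ξ i) / (p (i + 1) : ℝ) := by field_simp
  rw [h3, e, Real.div_rpow (by positivity) hp0.le]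
  ring

open Topology in
theorem pntc_atTop (a : ℝ) (ha : -1 < a) : Tendsto (fun n : ℕ ↦ pntc a n) atTop atTop := by
  have h := (isLittleO_log_rpow_rpow_atTop (-a) (show 0 < a + 1 by linarith)).tendsto_div_nhds_zero
  have h2 : Tendsto (fun x : ℝ ↦ log x ^ (-a) / x ^ (a + 1)) atTop (𝓝[>] 0) := by
    rw [tendsto_nhdsWithin_iff]
    refine ⟨h, ?_⟩
    filter_upwards [eventually_gt_atTop 1] with x hx
    have := Real.log_pos hx
    have : 0 < log x ^ (-a) / x ^ (a + 1) := by positivity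
    exact this
  have h3 := (h2.inv_tendsto_nhdsGT_zero.atTop_div_const (show 0 < a + 1 by linarith)).comp
    tendsto_natCast_atTop_atTop
  refine h3.congr' ?_
  filter_upwards [eventually_gt_atTop 1] with n hn
  have hl : 0 < log (n : ℝ) := Real.log_pos (by exact_mod_cast hn)
  simp only [Function.comp, Pi.inv_apply, pntc]
  rw [Real.rpow_neg hl.le, inv_div, div_inv_eq_mul]

open Topology in
theorem stmt_17 (a : ℝ) (ha : -1 < a) :
    (fun n : ℕ => ∑ r ∈ Finset.Icc 1 n, (p r : ℝ) ^ a) ~[atTop]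
      (fun n : ℕ => (n : ℝ) * (p n : ℝ) ^ a / (a + 1)) := by
  set g : ℕ → ℝ := fun i ↦ (p (i + 1) : ℝ) ^ a with hg
  set d : ℕ → ℝ := fun i ↦ pntc a ((i + 1 : ℕ) : ℝ) - pntc a i with hd
  have hppos (i : ℕ) : (0 : ℝ) < p (i + 1) := by
    have : (p (i + 1)).Prime := Nat.prime_nth_prime _
    exact_mod_cast this.pos
  have hgpos (i : ℕ) : 0 < g i := Real.rpow_pos_of_pos (hppos i) a
  have hc0 : pntc a 0 = 0 := by
    have : a + 1 ≠ 0 := by linarith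
    simp [pntc, this]
  have hdsum (n : ℕ) : ∑ i ∈ Finset.range n, d i = pntc a n := by
    have := Finset.sum_range_sub (fun i : ℕ ↦ pntc a i) n
    simp only [Nat.cast_zero, hc0, sub_zero] at this
    exact this
  have hdg : d ~[atTop] g := by
    refine (isEquivalent_iff_tendsto_one ?_).2 (pntc_diff a ha)
    exact Eventually.of_forall fun i ↦ (hgpos i).ne'
  have hgtop : Tendsto (fun n ↦ ∑ i ∈ Finset.range n, g i) atTop atTop := by
    rw [← not_summable_iff_tendsto_nat_atTop_of_nonneg fun i ↦ (hgpos i).le]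
    intro hs
    have hds : Summable d := summable_of_isBigO_nat hs hdg.isBigO
    have := hds.hasSum.tendsto_sum_nat
    simp_rw [hdsum] at this
    exact not_tendsto_nhds_of_tendsto_atTop (pntc_atTop a ha) _ this
  have hsum : (fun n : ℕ ↦ pntc a n) ~[atTop] (fun n ↦ ∑ i ∈ Finset.range n, g i) := by
    have := hdg.isLittleO.sum_range (fun i ↦ (hgpos i).le) hgtop
    refine this.congr_left fun n ↦ ?_
    simp only [Pi.sub_apply, Finset.sum_sub_distrib, hdsum]
  have hS : (fun n : ℕ => ∑ r ∈ Finset.Icc 1 n, (p r : ℝ) ^ a) =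
      fun n ↦ ∑ i ∈ Finset.range n, g i := by
    ext n
    rw [Finset.range_eq_Ico, hg, Finset.sum_Ico_add' (fun i ↦ (p i : ℝ) ^ a) 0 n 1]
    rfl
  rw [hS]
  refine hsum.symm.trans ?_
  have ha1 : 0 < a + 1 := by linarith
  have hlast : Tendsto (fun n : ℕ ↦ pntc a ((n + 1 : ℕ) : ℝ) /
      (((n + 1 : ℕ) : ℝ) * (p (n + 1) : ℝ) ^ a / (a + 1))) atTop (𝓝 1) := by
    have := pnt_p.rpow_const (p := a) (Or.inl one_ne_zero)
    rw [Real.one_rpow] at this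
    refine this.congr' ?_
    filter_upwards [eventually_ge_atTop 1] with n hn
    have hn' : (1 : ℝ) ≤ n := by exact_mod_cast hn
    have hl : 0 < log ((n + 1 : ℕ) : ℝ) := Real.log_pos (by push_cast; linarith)
    have hp : 0 < ((n + 1 : ℕ) : ℝ) := by positivity
    have := hgpos n
    simp only [hg] at this
    rw [Real.div_rpow (by positivity) (hppos n).le, Real.mul_rpow hp.le hl.le, pntc,
      Real.rpow_add_one hp.ne']
    field_simp
  rw [isEquivalent_iff_tendsto_one]
  · exact (tendsto_add_atTop_iff_nat 1).1 hlast
  · rw [eventually_atTop]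
    refine ⟨1, fun n hn ↦ ?_⟩
    obtain ⟨m, rfl⟩ : ∃ m, n = m + 1 := ⟨n - 1, by omega⟩
    have := hgpos m
    simp only [hg] at this
    positivity
end

section
/- If a_n ≥ 0 for all sufficiently large n, where a_n = -(1/ln n) ln(p_n^(1/n)/p_{n+1}^(1/(n+1)) - 1) is defined whenever p_n^(1/n) > p_{n+1}^(1/(n+1)), and a_n is defined for all sufficiently large n, then p_{n+1} - p_n < (ln p_n)^2 - ln p_n + 1 for all sufficiently large n. -/
open Filter Real

/-- `a n` from Definition 2.1, defined whenever `p n ^ (1/n) > p (n+1) ^ (1/(n+1))`. -/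
noncomputable def a (n : ℕ) : ℝ :=
  -(1 / Real.log n) *
    Real.log ((p n : ℝ) ^ ((1 : ℝ) / n) / (p (n + 1) : ℝ) ^ ((1 : ℝ) / (n + 1)) - 1)


lemma cpow_diff_bound {m x : ℝ} (hm : 1 ≤ m) (hx : x ∈ Set.Icc m (m + 1)) {s : ℂ} (hs : 0 < s.re) :
    ‖(x : ℂ) ^ (-s) - (m : ℂ) ^ (-s)‖ ≤ 2 * ‖s‖ ^ ((1 : ℝ) / 70) * m ^ (-s.re - 1 / 70) := by
  have hm0 : 0 < m := by linarith
  have hs0 : s ≠ 0 := by rintro rfl; simp at hs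
  have hspos : 0 < ‖s‖ := norm_pos_iff.mpr hs0
  set D := ‖(x : ℂ) ^ (-s) - (m : ℂ) ^ (-s)‖ with hD
  have hD0 : 0 ≤ D := norm_nonneg _
  have h1 : D ≤ 2 * m ^ (-s.re) := by
    have e1 : ‖(x : ℂ) ^ (-s)‖ = x ^ (-s.re) := by
      rw [Complex.norm_cpow_eq_rpow_re_of_pos (by linarith [hx.1])]; simp
    have e2 : ‖(m : ℂ) ^ (-s)‖ = m ^ (-s.re) := by
      rw [Complex.norm_cpow_eq_rpow_re_of_pos hm0]; simp
    have e3 : x ^ (-s.re) ≤ m ^ (-s.re) := Real.rpow_le_rpow_of_nonpos hm0 hx.1 (by linarith)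
    have := norm_sub_le ((x : ℂ) ^ (-s)) ((m : ℂ) ^ (-s))
    rw [e1, e2] at this
    linarith
  have h2 : D ≤ ‖s‖ * m ^ (-s.re - 1) := by
    have key := norm_image_sub_le_of_norm_deriv_le_segment' (f := fun y : ℝ => (y : ℂ) ^ (-s))
      (a := m) (b := m + 1) (f' := fun y : ℝ => (-s) * (y : ℂ) ^ (-s - 1))
      (C := ‖s‖ * m ^ (-s.re - 1)) ?_ ?_ x hx
    · refine key.trans ?_
      have : 0 ≤ ‖s‖ * m ^ (-s.re - 1) := by positivity
      nlinarith [hx.2]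
    · intro y hy
      exact (hasDerivAt_ofReal_cpow_const (by linarith [hy.1]) (neg_ne_zero.mpr hs0)).hasDerivWithinAt
    · intro y hy
      rw [norm_mul, norm_neg, Complex.norm_cpow_eq_rpow_re_of_pos (by linarith [hy.1])]
      gcongr
      simp only [Complex.sub_re, Complex.neg_re, Complex.one_re]
      exact Real.rpow_le_rpow_of_nonpos hm0 hy.1 (by linarith)
  have h3 : D = D ^ ((69 : ℝ) / 70) * D ^ ((1 : ℝ) / 70) := by
    rw [← Real.rpow_add' hD0 (by norm_num)]; norm_num
  rw [h3]
  calc D ^ ((69 : ℝ) / 70) * D ^ ((1 : ℝ) / 70)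
      ≤ (2 * m ^ (-s.re)) ^ ((69 : ℝ) / 70) * (‖s‖ * m ^ (-s.re - 1)) ^ ((1 : ℝ) / 70) := by
        gcongr
    _ = (2 : ℝ) ^ ((69 : ℝ) / 70) * ‖s‖ ^ ((1 : ℝ) / 70) * m ^ (-s.re - 1 / 70) := by
        rw [Real.mul_rpow (by norm_num) (by positivity), Real.mul_rpow hspos.le (by positivity),
          ← Real.rpow_mul hm0.le, ← Real.rpow_mul hm0.le]
        have : m ^ (-s.re - 1 / 70) = m ^ (-s.re * (69 / 70)) * m ^ ((-s.re - 1) * (1 / 70)) := by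
          rw [← Real.rpow_add hm0]; congr 1; ring
        rw [this]; ring
    _ ≤ 2 * ‖s‖ ^ ((1 : ℝ) / 70) * m ^ (-s.re - 1 / 70) := by
        have : (2 : ℝ) ^ ((69 : ℝ) / 70) ≤ 2 := by
          calc (2 : ℝ) ^ ((69 : ℝ) / 70) ≤ (2 : ℝ) ^ (1 : ℝ) :=
                Real.rpow_le_rpow_of_exponent_le (by norm_num) (by norm_num)
            _ = 2 := by simp
        gcongr

/-- summand of `(s-1) ζ(s) - 1` -/
noncomputable def vterm (n : ℕ) (s : ℂ) : ℂ :=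
  (s - 1) * (((n : ℝ) + 1 : ℝ) : ℂ) ^ (-s) + (((n : ℝ) + 1 + 1 : ℝ) : ℂ) ^ (1 - s)
    - (((n : ℝ) + 1 : ℝ) : ℂ) ^ (1 - s)

lemma vterm_bound (n : ℕ) {s : ℂ} (hs : 0 < s.re) :
    ‖vterm n s‖ ≤ ‖s - 1‖ * (2 * ‖s‖ ^ ((1 : ℝ) / 70) * ((n : ℝ) + 1) ^ (-s.re - 1 / 70)) := by
  by_cases h1 : s = 1
  · subst h1; simp [vterm]
  have hs1 : 1 - s ≠ 0 := sub_ne_zero.mpr (Ne.symm h1)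
  set m : ℝ := (n : ℝ) + 1 with hm
  have hm1 : 1 ≤ m := by rw [hm]; have : (0 : ℝ) ≤ n := Nat.cast_nonneg n; linarith
  have key := norm_image_sub_le_of_norm_deriv_le_segment'
      (f := fun y : ℝ => (s - 1) * ((y : ℂ) * (m : ℂ) ^ (-s)) + (y : ℂ) ^ (1 - s))
      (a := m) (b := m + 1)
      (f' := fun y : ℝ => (s - 1) * ((1 : ℂ) * (m : ℂ) ^ (-s)) + (1 - s) * (y : ℂ) ^ (1 - s - 1))
      (C := ‖s - 1‖ * (2 * ‖s‖ ^ ((1 : ℝ) / 70) * m ^ (-s.re - 1 / 70))) ?_ ?_ (m + 1)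
        ⟨by linarith, le_rfl⟩
  · have e : vterm n s = ((s - 1) * (((m + 1 : ℝ) : ℂ) * (m : ℂ) ^ (-s)) + ((m + 1 : ℝ) : ℂ) ^ (1 - s))
        - ((s - 1) * ((m : ℂ) * (m : ℂ) ^ (-s)) + (m : ℂ) ^ (1 - s)) := by
      unfold vterm
      rw [← hm]; push_cast; ring
    rw [e]
    refine key.trans (le_of_eq ?_)
    ring
  · intro y hy
    refine HasDerivAt.hasDerivWithinAt ?_
    refine HasDerivAt.add ?_ (hasDerivAt_ofReal_cpow_const (by linarith [hy.1]) hs1)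
    exact ((Complex.ofRealCLM.hasDerivAt (x := y)).mul_const _).const_mul _
  · intro y hy
    have e : (s - 1) * ((1 : ℂ) * (m : ℂ) ^ (-s)) + (1 - s) * (y : ℂ) ^ (1 - s - 1)
        = -((s - 1) * ((y : ℂ) ^ (-s) - (m : ℂ) ^ (-s))) := by
      rw [show 1 - s - 1 = -s by ring]; ring
    rw [e, norm_neg, norm_mul]
    gcongr
    exact cpow_diff_bound hm1 ⟨hy.1, hy.2.le⟩ hs

lemma summable_aux : Summable (fun n : ℕ => ((n : ℝ) + 1) ^ (-(1 : ℝ) - 1 / 140)) := by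
  have := (summable_nat_add_iff 1).mpr (Real.summable_nat_rpow (p := -(1 : ℝ) - 1 / 140) |>.mpr (by norm_num))
  simpa using this

lemma vterm_bound' (n : ℕ) {s : ℂ} (hs : 139 / 140 ≤ s.re) :
    ‖vterm n s‖ ≤ ‖s - 1‖ * (2 * ‖s‖ ^ ((1 : ℝ) / 70)) * ((n : ℝ) + 1) ^ (-(1 : ℝ) - 1 / 140) := by
  refine (vterm_bound n (by linarith)).trans ?_
  rw [← mul_assoc]
  have : ((n : ℝ) + 1) ^ (-s.re - 1 / 70) ≤ ((n : ℝ) + 1) ^ (-(1 : ℝ) - 1 / 140) := by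
    apply Real.rpow_le_rpow_of_exponent_le
    · have : (0 : ℝ) ≤ n := Nat.cast_nonneg n
      linarith
    · linarith
  gcongr

lemma vterm_partial (N : ℕ) (s : ℂ) : ∑ n ∈ Finset.range N, vterm n s =
    (s - 1) * ∑ n ∈ Finset.range N, (((n : ℝ) + 1 : ℝ) : ℂ) ^ (-s) + (((N : ℝ) + 1 : ℝ) : ℂ) ^ (1 - s) - 1 := by
  induction N with
  | zero => simp
  | succ N ih =>
    rw [Finset.sum_range_succ, ih, Finset.sum_range_succ, vterm]
    push_cast
    ring

lemma vterm_tsum {s : ℂ} (hs : 1 < s.re) : ∑' n, vterm n s = (s - 1) * riemannZeta s - 1 := by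
  have hsum : Summable (fun n => vterm n s) :=
    Summable.of_norm_bounded (summable_aux.mul_left (‖s - 1‖ * (2 * ‖s‖ ^ ((1 : ℝ) / 70))))
      (fun n => vterm_bound' n (by linarith))
  refine tendsto_nhds_unique hsum.hasSum.tendsto_sum_nat ?_
  simp_rw [vterm_partial]
  have hz : HasSum (fun n : ℕ => (((n : ℝ) + 1 : ℝ) : ℂ) ^ (-s)) (riemannZeta s) := by
    have h1 : Summable (fun n : ℕ => (((n : ℝ) + 1 : ℝ) : ℂ) ^ (-s)) := by
      have := (summable_nat_add_iff 1).mpr (Complex.summable_one_div_nat_cpow.mpr hs)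
      simpa [Complex.cpow_neg] using this
    have h2 := h1.hasSum
    convert h2 using 1
    rw [zeta_eq_tsum_one_div_nat_add_one_cpow hs]
    simp [Complex.cpow_neg]
  have h0 : Tendsto (fun N : ℕ => (((N : ℝ) + 1 : ℝ) : ℂ) ^ (1 - s)) atTop (nhds 0) := by
    rw [tendsto_zero_iff_norm_tendsto_zero]
    have : ∀ N : ℕ, ‖(((N : ℝ) + 1 : ℝ) : ℂ) ^ (1 - s)‖ = ((N : ℝ) + 1) ^ (-(s.re - 1)) := by
      intro N
      rw [Complex.norm_cpow_eq_rpow_re_of_pos (by positivity)]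
      simp
    simp_rw [this]
    exact (tendsto_rpow_neg_atTop (by linarith)).comp
      (tendsto_atTop_add_const_right _ _ tendsto_natCast_atTop_atTop)
  have := ((hz.tendsto_sum_nat.const_mul (s - 1)).add h0).sub_const 1
  simpa using this

lemma zeta0_eq_tsum {s : ℂ} (hs : 139 / 140 < s.re) :
    (s - 1) * riemannZeta₀ s = ∑' n, vterm n s := by
  set R : ℝ := ‖s‖ + 3
  set U : Set ℂ := {z | 139 / 140 < z.re} ∩ Metric.ball 0 R with hU
  have hUo : IsOpen U := (isOpen_lt continuous_const Complex.continuous_re).inter Metric.isOpen_ball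
  have hUc : Convex ℝ U := (convex_halfSpace_re_gt _).inter (convex_ball _ _)
  have hsU : s ∈ U := ⟨hs, by simp [R]⟩
  have h2U : (2 : ℂ) ∈ U := ⟨by norm_num, by simp [R]; linarith [norm_nonneg s]⟩
  have hd1 : DifferentiableOn ℂ (fun z => (z - 1) * riemannZeta₀ z) U := by
    have := differentiable_riemannZeta₀
    fun_prop
  have hd2 : DifferentiableOn ℂ (fun z => ∑' n, vterm n z) U := by
    refine Complex.differentiableOn_tsum_of_summable_norm
      (u := fun n : ℕ => ((R + 1) * (2 * R ^ ((1 : ℝ) / 70))) * ((n : ℝ) + 1) ^ (-(1 : ℝ) - 1 / 140))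
      (summable_aux.mul_left _) ?_ hUo ?_
    · intro n
      have hn : (((n : ℝ) + 1 : ℝ) : ℂ) ≠ 0 := by
        exact_mod_cast (by positivity : ((n : ℝ) + 1) ≠ 0)
      have hn' : (((n : ℝ) + 1 + 1 : ℝ) : ℂ) ≠ 0 := by
        exact_mod_cast (by positivity : ((n : ℝ) + 1 + 1) ≠ 0)
      unfold vterm
      refine Differentiable.differentiableOn ?_
      have k1 : Differentiable ℂ (fun z : ℂ => (((n : ℝ) + 1 : ℝ) : ℂ) ^ (-z)) :=
        fun z => (differentiableAt_id.neg).const_cpow (Or.inl hn)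
      have k2 : Differentiable ℂ (fun z : ℂ => (((n : ℝ) + 1 : ℝ) : ℂ) ^ (1 - z)) :=
        fun z => (differentiableAt_id.const_sub 1).const_cpow (Or.inl hn)
      have k3 : Differentiable ℂ (fun z : ℂ => (((n : ℝ) + 1 + 1 : ℝ) : ℂ) ^ (1 - z)) :=
        fun z => (differentiableAt_id.const_sub 1).const_cpow (Or.inl hn')
      exact (((differentiable_id.sub_const 1).mul k1).add k3).sub k2
    · intro n w hw
      refine (vterm_bound' n hw.1.le).trans ?_
      have hw2 : ‖w‖ ≤ R := by have := hw.2; simp at this; exact this.le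
      have hw3 : ‖w - 1‖ ≤ R + 1 := by
        have := norm_sub_le w 1; simp at this; linarith
      gcongr
  have := AnalyticOnNhd.eqOn_of_preconnected_of_eventuallyEq (hd1.analyticOnNhd hUo)
    (hd2.analyticOnNhd hUo) hUc.isPreconnected h2U ?_
  · exact this hsU
  · have : {z : ℂ | 1 < z.re} ∈ nhds (2 : ℂ) :=
      (isOpen_lt continuous_const Complex.continuous_re).mem_nhds (by norm_num)
    filter_upwards [this] with z hz
    have hz' : (1 : ℝ) < z.re := hz
    have hz1 : z ≠ 1 := by rintro rfl; simp at hz'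
    rw [vterm_tsum hz, riemannZeta_eq_inv_sub_add hz1]
    have := sub_ne_zero.mpr hz1
    field_simp
    ring

/-- the growth scale -/
noncomputable def Q (t : ℝ) : ℝ := (1 + |t|) ^ ((1 : ℝ) / 280)

lemma Q_one_le (t : ℝ) : 1 ≤ Q t :=
  Real.one_le_rpow (by linarith [abs_nonneg t]) (by norm_num)

lemma Q_le {t u : ℝ} (h : |t| ≤ 2 * |u| + 1) : Q t ≤ 2 * Q u := by
  unfold Q
  have h0 := abs_nonneg u
  calc (1 + |t|) ^ ((1 : ℝ) / 280) ≤ (2 * (1 + |u|)) ^ ((1 : ℝ) / 280) := by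
        gcongr; linarith
    _ = 2 ^ ((1 : ℝ) / 280) * (1 + |u|) ^ ((1 : ℝ) / 280) := Real.mul_rpow (by norm_num) (by positivity)
    _ ≤ 2 * (1 + |u|) ^ ((1 : ℝ) / 280) := by
        have : (2 : ℝ) ^ ((1 : ℝ) / 280) ≤ 2 := by
          calc (2 : ℝ) ^ ((1 : ℝ) / 280) ≤ (2 : ℝ) ^ (1 : ℝ) :=
                Real.rpow_le_rpow_of_exponent_le (by norm_num) (by norm_num)
            _ = 2 := by simp
        gcongr

lemma zeta0_bound : ∃ C : ℝ, 1 ≤ C ∧ ∀ s : ℂ, 139 / 140 < s.re → s.re ≤ 3 →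
    ‖riemannZeta₀ s‖ ≤ C * Q s.im ^ 4 := by
  set S := ∑' n : ℕ, ((n : ℝ) + 1) ^ (-(1 : ℝ) - 1 / 140) with hS
  have hS0 : 0 ≤ S := tsum_nonneg (fun n => by positivity)
  refine ⟨1 + ‖riemannZeta₀ 1‖ + 8 * S, by have := norm_nonneg (riemannZeta₀ 1); linarith, ?_⟩
  intro s hs hs3
  have hQ : Q s.im ^ 4 = (1 + |s.im|) ^ ((1 : ℝ) / 70) := by
    unfold Q
    rw [← Real.rpow_natCast, ← Real.rpow_mul (by positivity)]
    norm_num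
  have hQ1 : 1 ≤ Q s.im ^ 4 := one_le_pow₀ (Q_one_le _)
  have hn1 := norm_nonneg (riemannZeta₀ 1)
  by_cases h1 : s = 1
  · rw [h1] at hQ1 ⊢
    nlinarith
  have hsum : Summable (fun n => ‖vterm n s‖) :=
    Summable.of_nonneg_of_le (fun n => norm_nonneg _) (fun n => vterm_bound' n hs.le)
      (summable_aux.mul_left _)
  have h2 : ‖s - 1‖ * ‖riemannZeta₀ s‖ ≤ ‖s - 1‖ * ((2 * ‖s‖ ^ ((1 : ℝ) / 70)) * S) := by
    rw [← norm_mul, zeta0_eq_tsum hs]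
    refine (norm_tsum_le_tsum_norm hsum).trans ?_
    rw [hS, ← mul_assoc, ← tsum_mul_left]
    exact hsum.tsum_le_tsum (fun n => vterm_bound' n hs.le) (summable_aux.mul_left _)
  have h3 : 0 < ‖s - 1‖ := norm_pos_iff.mpr (sub_ne_zero.mpr h1)
  have h4 := le_of_mul_le_mul_left h2 h3
  have h5 : ‖s‖ ≤ 4 * (1 + |s.im|) := by
    have := Complex.norm_le_abs_re_add_abs_im s
    rw [abs_of_pos (by linarith : 0 < s.re)] at this
    linarith [abs_nonneg s.im]
  have h6 : ‖s‖ ^ ((1 : ℝ) / 70) ≤ 4 * Q s.im ^ 4 := by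
    rw [hQ]
    calc ‖s‖ ^ ((1 : ℝ) / 70) ≤ (4 * (1 + |s.im|)) ^ ((1 : ℝ) / 70) := by gcongr
      _ = 4 ^ ((1 : ℝ) / 70) * (1 + |s.im|) ^ ((1 : ℝ) / 70) :=
          Real.mul_rpow (by norm_num) (by positivity)
      _ ≤ 4 * (1 + |s.im|) ^ ((1 : ℝ) / 70) := by
          have : (4 : ℝ) ^ ((1 : ℝ) / 70) ≤ 4 := by
            calc (4 : ℝ) ^ ((1 : ℝ) / 70) ≤ (4 : ℝ) ^ (1 : ℝ) :=
                  Real.rpow_le_rpow_of_exponent_le (by norm_num) (by norm_num)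
              _ = 4 := by simp
          gcongr
  calc ‖riemannZeta₀ s‖ ≤ (2 * ‖s‖ ^ ((1 : ℝ) / 70)) * S := h4
    _ ≤ (2 * (4 * Q s.im ^ 4)) * S := by gcongr
    _ ≤ (1 + ‖riemannZeta₀ 1‖ + 8 * S) * Q s.im ^ 4 := by nlinarith

lemma zeta0_deriv_bound : ∃ C : ℝ, 1 ≤ C ∧ ∀ s : ℂ, 279 / 280 ≤ s.re → s.re ≤ 2 →
    ‖deriv riemannZeta₀ s‖ ≤ C * Q s.im ^ 4 := by
  obtain ⟨C, hC, h⟩ := zeta0_bound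
  refine ⟨C * 16 * 560, by linarith, ?_⟩
  intro s hs1 hs2
  have := Complex.norm_deriv_le_of_forall_mem_sphere_norm_le (f := riemannZeta₀) (c := s)
    (R := 1 / 560) (C := C * (2 * Q s.im) ^ 4) (by norm_num)
    (differentiable_riemannZeta₀.diffContOnCl) ?_
  · refine this.trans (le_of_eq ?_)
    ring
  · intro z hz
    have hz' : ‖z - s‖ = 1 / 560 := by simpa [dist_eq_norm] using hz
    have h1 := Complex.abs_re_le_norm (z - s)
    have h2 := Complex.abs_im_le_norm (z - s)
    rw [hz', Complex.sub_re, abs_le] at h1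
    rw [hz', Complex.sub_im] at h2
    refine (h z (by linarith [h1.1]) (by linarith [h1.2])).trans ?_
    have h3 : |z.im| ≤ 2 * |s.im| + 1 := by
      have := abs_sub_abs_le_abs_sub z.im s.im
      linarith [abs_nonneg s.im]
    have := Q_le h3
    have := Q_one_le z.im
    gcongr

lemma ne_one_of_im {s : ℂ} (h : 1 ≤ |s.im|) : s ≠ 1 := by
  rintro rfl
  norm_num at h

lemma one_le_norm_sub_one {s : ℂ} (h : 1 ≤ |s.im|) : 1 ≤ ‖s - 1‖ := by
  have := Complex.abs_im_le_norm (s - 1)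
  simp at this
  linarith

lemma zeta_upper : ∃ C : ℝ, 1 ≤ C ∧ ∀ s : ℂ, 139 / 140 < s.re → s.re ≤ 3 → 1 ≤ |s.im| →
    ‖riemannZeta s‖ ≤ C * Q s.im ^ 4 := by
  obtain ⟨C, hC, h⟩ := zeta0_bound
  refine ⟨1 + C, by linarith, fun s h1 h2 h3 => ?_⟩
  rw [riemannZeta_eq_inv_sub_add (ne_one_of_im h3)]
  refine (norm_add_le _ _).trans ?_
  have h4 : ‖(s - 1)⁻¹‖ ≤ 1 := by
    rw [norm_inv]; exact inv_le_one_of_one_le₀ (one_le_norm_sub_one h3)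
  have hQ1 : 1 ≤ Q s.im ^ 4 := one_le_pow₀ (Q_one_le _)
  linarith [h s h1 h2]

lemma zeta_near_one : ∃ C : ℝ, 1 ≤ C ∧ ∀ x : ℝ, 0 < x → x ≤ 1 →
    ‖riemannZeta (1 + x)‖ ≤ C / x := by
  obtain ⟨C, hC, h⟩ := zeta0_bound
  refine ⟨1 + C, by linarith, fun x h1 h2 => ?_⟩
  have hx : (x : ℂ) ≠ 0 := by exact_mod_cast h1.ne'
  rw [riemannZeta_eq_inv_sub_add (by simpa using h1.ne')]
  refine (norm_add_le _ _).trans ?_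
  have h4 := h (1 + x) (by simp; linarith) (by simp; linarith)
  have : Q ((1 : ℂ) + x).im = 1 := by simp [Q]
  rw [this] at h4
  rw [add_sub_cancel_left, norm_inv, Complex.norm_real, Real.norm_eq_abs, abs_of_pos h1, add_div]
  have h5 : C ≤ C / x := by rw [le_div_iff₀ h1]; nlinarith
  rw [one_div]
  linarith

lemma zeta_lower4 : ∃ c : ℝ, 0 < c ∧ c ≤ 1 ∧ ∀ s : ℂ, 1 < s.re → s.re ≤ 2 → 1 ≤ |s.im| →
    c * (s.re - 1) ^ 3 ≤ ‖riemannZeta s‖ ^ 4 * Q s.im ^ 4 := by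
  obtain ⟨C₁, hC₁, h1⟩ := zeta_near_one
  obtain ⟨C₂, hC₂, h2⟩ := zeta_upper
  refine ⟨1 / (C₁ ^ 3 * (C₂ * 16)), by positivity, ?_, ?_⟩
  · rw [div_le_one (by positivity)]
    have : 1 ≤ C₁ ^ 3 := one_le_pow₀ hC₁
    nlinarith
  intro s hs1 hs2 ht
  set x := s.re - 1 with hx
  have hx0 : 0 < x := by linarith
  have key := DirichletCharacter.norm_LFunction_product_ge_one (1 : DirichletCharacter ℂ 1) hx0 s.im
  have e1 : (1 : ℂ) + x + Complex.I * s.im = s := by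
    apply Complex.ext <;> simp [hx]
  have e2 : DirichletCharacter.LFunctionTrivChar 1 = riemannZeta := by
    unfold DirichletCharacter.LFunctionTrivChar
    exact DirichletCharacter.LFunction_modOne_eq
  rw [e1, e2, DirichletCharacter.LFunction_modOne_eq, DirichletCharacter.LFunction_modOne_eq,
    norm_mul, norm_mul, norm_pow, norm_pow] at key
  set w : ℂ := 1 + x + 2 * Complex.I * s.im with hw
  have hwre : w.re = s.re := by simp [hw, hx]
  have hwim : w.im = 2 * s.im := by simp [hw]
  have h3 := h1 x hx0 (by linarith)
  have h4 := h2 w (by rw [hwre]; linarith) (by rw [hwre]; linarith)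
    (by rw [hwim, abs_mul]; norm_num; linarith)
  have h5 : Q w.im ≤ 2 * Q s.im := Q_le (by rw [hwim, abs_mul]; norm_num)
  have h6 := Q_one_le w.im
  have h7 : ‖riemannZeta w‖ ≤ C₂ * 16 * Q s.im ^ 4 := by
    calc _ ≤ C₂ * Q w.im ^ 4 := h4
      _ ≤ C₂ * (2 * Q s.im) ^ 4 := by gcongr
      _ = _ := by ring
  have h8 : 1 ≤ (C₁ / x) ^ 3 * ‖riemannZeta s‖ ^ 4 * (C₂ * 16 * Q s.im ^ 4) :=
    le_trans key (by gcongr)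
  rw [div_mul_eq_mul_div, one_mul, div_le_iff₀ (by positivity)]
  have h9 : (C₁ / x) ^ 3 * x ^ 3 = C₁ ^ 3 := by
    rw [← mul_pow, div_mul_cancel₀ _ hx0.ne']
  calc x ^ 3 = 1 * x ^ 3 := by ring
    _ ≤ ((C₁ / x) ^ 3 * ‖riemannZeta s‖ ^ 4 * (C₂ * 16 * Q s.im ^ 4)) * x ^ 3 := by gcongr
    _ = ‖riemannZeta s‖ ^ 4 * (C₂ * 16 * Q s.im ^ 4) * ((C₁ / x) ^ 3 * x ^ 3) := by ring
    _ = _ := by rw [h9]; ring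

lemma zeta_diff : ∃ C : ℝ, 1 ≤ C ∧ ∀ s w : ℂ, 279 / 280 ≤ s.re → s.re ≤ 2 →
    279 / 280 ≤ w.re → w.re ≤ 2 → s.im = w.im → 1 ≤ |s.im| →
    ‖riemannZeta s - riemannZeta w‖ ≤ C * Q s.im ^ 4 * ‖s - w‖ := by
  obtain ⟨C, hC, h⟩ := zeta0_deriv_bound
  refine ⟨C + 1, by linarith, fun s w hs1 hs2 hw1 hw2 him ht => ?_⟩
  have ht' : 1 ≤ |w.im| := him ▸ ht
  have hs := one_le_norm_sub_one ht
  have hw := one_le_norm_sub_one ht'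
  have hQ1 : 1 ≤ Q s.im ^ 4 := one_le_pow₀ (Q_one_le _)
  rw [riemannZeta_eq_inv_sub_add (ne_one_of_im ht), riemannZeta_eq_inv_sub_add (ne_one_of_im ht')]
  have h1 : ‖riemannZeta₀ s - riemannZeta₀ w‖ ≤ (C * Q s.im ^ 4) * ‖s - w‖ := by
    refine Convex.norm_image_sub_le_of_norm_deriv_le (s := segment ℝ w s) (f := riemannZeta₀)
      (fun z _ => differentiable_riemannZeta₀ z) ?_ (convex_segment _ _)
      (left_mem_segment ℝ w s) (right_mem_segment ℝ w s)
    intro z hz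
    obtain ⟨u, v, hu, hv, huv, rfl⟩ := hz
    have e1 : (u • w + v • s).im = s.im := by
      simp [← him]; rw [← add_mul, huv, one_mul]
    have e2 : (u • w + v • s).re = u * w.re + v * s.re := by simp
    have := h (u • w + v • s) (by rw [e2]; nlinarith) (by rw [e2]; nlinarith)
    rwa [e1] at this
  have h2 : ‖(s - 1)⁻¹ - (w - 1)⁻¹‖ ≤ ‖s - w‖ := by
    have e : (s - 1)⁻¹ - (w - 1)⁻¹ = (w - s) * ((s - 1)⁻¹ * (w - 1)⁻¹) := by
      have := sub_ne_zero.mpr (ne_one_of_im ht)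
      have := sub_ne_zero.mpr (ne_one_of_im ht')
      field_simp
      ring
    rw [e, norm_mul, norm_mul, norm_inv, norm_inv, norm_sub_rev w s]
    have a1 := inv_le_one_of_one_le₀ hs
    have a2 := inv_le_one_of_one_le₀ hw
    have a3 : ‖s - 1‖⁻¹ * ‖w - 1‖⁻¹ ≤ 1 := mul_le_one₀ a1 (by positivity) a2
    nlinarith [norm_nonneg (s - w)]
  have e3 : (s - 1)⁻¹ + riemannZeta₀ s - ((w - 1)⁻¹ + riemannZeta₀ w)
      = ((s - 1)⁻¹ - (w - 1)⁻¹) + (riemannZeta₀ s - riemannZeta₀ w) := by ring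
  rw [e3]
  refine (norm_add_le _ _).trans ?_
  nlinarith [norm_nonneg (s - w)]

lemma zeta_lower : ∃ c d : ℝ, 0 < c ∧ c ≤ 1 / 280 ∧ 0 < d ∧ ∀ s : ℂ, 1 ≤ |s.im| →
    1 - c / Q s.im ^ 20 ≤ s.re → s.re ≤ 2 → d / Q s.im ^ 16 ≤ ‖riemannZeta s‖ := by
  obtain ⟨e, he, he1, h4⟩ := zeta_lower4
  obtain ⟨C, hC, hd⟩ := zeta_diff
  set b : ℝ := min (1 / 5) (e / (4 * C)) with hb
  have hb0 : 0 < b := by rw [hb]; positivity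
  have hb1 : b ≤ 1 / 5 := min_le_left _ _
  have hb2 : b * (4 * C) ≤ e := by
    have : b ≤ e / (4 * C) := min_le_right _ _
    rwa [le_div_iff₀ (by positivity)] at this
  have hb4 : b ^ 4 ≤ 1 / 280 := by
    calc b ^ 4 ≤ (1 / 5) ^ 4 := by gcongr
      _ ≤ _ := by norm_num
  refine ⟨b ^ 4, e * b ^ 3 / 2, by positivity, hb4, by positivity, ?_⟩
  intro s ht hs1 hs2
  set q := Q s.im with hq
  have hq1 : 1 ≤ q := Q_one_le _
  set r := b ^ 4 / q ^ 20 with hr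
  have hr0 : 0 < r := by positivity
  have hr1 : r ≤ 1 / 280 := by
    rw [hr, div_le_iff₀ (by positivity)]
    have : 1 ≤ q ^ 20 := one_le_pow₀ hq1
    nlinarith
  -- lower bound to the right
  have right : ∀ w : ℂ, w.im = s.im → 1 + r ≤ w.re → w.re ≤ 2 →
      e * b ^ 3 / q ^ 16 ≤ ‖riemannZeta w‖ := by
    intro w hw hw1 hw2
    have k := h4 w (by linarith) hw2 (by rw [hw]; exact ht)
    rw [hw, ← hq, ← mul_pow] at k
    have k2 : (e * b ^ 3 / q ^ 15) ^ 4 ≤ (‖riemannZeta w‖ * q) ^ 4 := by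
      refine le_trans ?_ k
      have e4 : e ^ 4 ≤ e := by
        calc e ^ 4 = e * e ^ 3 := by ring
          _ ≤ e * 1 := by gcongr; exact pow_le_one₀ he.le he1
          _ = e := by ring
      have k3 : (e * b ^ 3 / q ^ 15) ^ 4 = e ^ 4 * r ^ 3 := by
        rw [hr]; field_simp
      rw [k3]
      have : r ≤ w.re - 1 := by linarith
      gcongr
    have k5 := le_of_pow_le_pow_left₀ (by norm_num) (by positivity) k2
    have : e * b ^ 3 / q ^ 16 = e * b ^ 3 / q ^ 15 / q := by field_simp
    rw [this, div_le_iff₀ (by positivity)]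
    exact k5
  by_cases hcase : 1 + r ≤ s.re
  · refine le_trans ?_ (right s rfl hcase hs2)
    gcongr
    have : 0 < e * b ^ 3 := by positivity
    linarith
  · push Not at hcase
    set w : ℂ := ⟨1 + r, s.im⟩ with hw
    have k1 := right w rfl le_rfl (by show 1 + r ≤ 2; linarith)
    have k2 := hd w s (by show 279 / 280 ≤ 1 + r; linarith) (by show 1 + r ≤ 2; linarith)
      (by linarith) hs2 rfl ht
    have k3 : ‖w - s‖ ≤ 2 * r := by
      have := Complex.norm_le_abs_re_add_abs_im (w - s)
      have i0 : (w - s).im = 0 := by simp [hw]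
      have i1 : (w - s).re = 1 + r - s.re := by simp [hw]
      rw [i0, i1, abs_zero, add_zero, abs_of_pos (by linarith)] at this
      linarith
    have k4 : C * Q w.im ^ 4 * ‖w - s‖ ≤ C * q ^ 4 * (2 * r) := by
      show C * q ^ 4 * ‖w - s‖ ≤ _
      gcongr
    have k5 : C * q ^ 4 * (2 * r) = 2 * C * b ^ 4 / q ^ 16 := by
      rw [hr]; field_simp
    have k6 : 2 * C * b ^ 4 / q ^ 16 ≤ e * b ^ 3 / 2 / q ^ 16 := by
      gcongr
      have : 0 < b ^ 3 := by positivity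
      nlinarith
    have k7 : e * b ^ 3 / q ^ 16 = e * b ^ 3 / 2 / q ^ 16 + e * b ^ 3 / 2 / q ^ 16 := by ring
    have k8 := norm_sub_norm_le (riemannZeta w) (riemannZeta s)
    linarith

/-- the analytic continuation of `∑ (Λ(n) - 1) n^{-s}` -/
noncomputable def FF (s : ℂ) : ℂ := -(deriv riemannZeta₁ s / riemannZeta₁ s) - riemannZeta₀ s

lemma FF_analyticAt {s : ℂ} (h : riemannZeta₁ s ≠ 0) : AnalyticAt ℂ FF s := by
  have h1 : AnalyticAt ℂ riemannZeta₁ s := differentiable_riemannZeta₁.analyticAt s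
  have h0 : AnalyticAt ℂ riemannZeta₀ s := differentiable_riemannZeta₀.analyticAt s
  exact ((h1.deriv.div h1 h).neg).sub h0

lemma zeta1_eq {s : ℂ} (hs : s ≠ 1) : riemannZeta₁ s = (s - 1) * riemannZeta s := by
  rw [riemannZeta_eq_inv_sub_mul hs, ← mul_assoc, mul_inv_cancel₀ (sub_ne_zero.mpr hs), one_mul]

lemma zeta1_ne_zero {s : ℂ} (hs : 1 ≤ s.re) : riemannZeta₁ s ≠ 0 := by
  by_cases h : s = 1
  · rw [h]; simp
  · rw [zeta1_eq h]
    exact mul_ne_zero (sub_ne_zero.mpr h) (riemannZeta_ne_zero_of_one_le_re hs)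

lemma deriv_zeta1 (s : ℂ) : deriv riemannZeta₁ s = riemannZeta₀ s + (s - 1) * deriv riemannZeta₀ s := by
  have h0 : HasDerivAt riemannZeta₀ (deriv riemannZeta₀ s) s :=
    (differentiable_riemannZeta₀ s).hasDerivAt
  have k : HasDerivAt (fun x => 1 + (x - 1) * riemannZeta₀ x)
      (1 * riemannZeta₀ s + (s - 1) * deriv riemannZeta₀ s) s :=
    (((hasDerivAt_id s).sub_const 1).mul h0).const_add 1
  have e : riemannZeta₁ = fun x => 1 + (x - 1) * riemannZeta₀ x := by
    funext x; simp [riemannZeta₁]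
  rw [e, k.deriv, one_mul]

lemma FF_bound : ∃ c C : ℝ, 0 < c ∧ c ≤ 1 / 280 ∧ 0 < C ∧ ∀ s : ℂ, 1 ≤ |s.im| →
    1 - c / Q s.im ^ 20 ≤ s.re → s.re ≤ 2 →
    riemannZeta₁ s ≠ 0 ∧ ‖FF s‖ ≤ C * Q s.im ^ 20 := by
  obtain ⟨c, d, hc, hc1, hd, h⟩ := zeta_lower
  obtain ⟨C₀, hC₀, h0⟩ := zeta0_bound
  obtain ⟨C₁, hC₁, h1⟩ := zeta0_deriv_bound
  refine ⟨c, (C₀ + C₁) / d + C₀, hc, hc1, by positivity, ?_⟩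
  intro s ht hs1 hs2
  have hz := h s ht hs1 hs2
  set q := Q s.im with hq
  have hq1 : 1 ≤ q := Q_one_le _
  have hs3 : 279 / 280 ≤ s.re := by
    have : c / q ^ 20 ≤ c := div_le_self hc.le (one_le_pow₀ hq1)
    linarith
  have hne := ne_one_of_im ht
  have hn1 := one_le_norm_sub_one ht
  have hz0 : 0 < ‖riemannZeta s‖ := lt_of_lt_of_le (by positivity) hz
  have hzz : riemannZeta₁ s ≠ 0 := by
    rw [zeta1_eq hne]
    exact mul_ne_zero (sub_ne_zero.mpr hne) (norm_pos_iff.mp hz0)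
  refine ⟨hzz, ?_⟩
  have b0 := h0 s (by linarith) (by linarith)
  have b1 := h1 s hs3 hs2
  rw [← hq] at b0 b1
  have e1 : ‖deriv riemannZeta₁ s / riemannZeta₁ s‖ ≤ (C₀ + C₁) / d * q ^ 20 := by
    rw [norm_div, zeta1_eq hne, norm_mul, div_le_iff₀ (by positivity), deriv_zeta1]
    have k1 : ‖riemannZeta₀ s + (s - 1) * deriv riemannZeta₀ s‖ ≤ ‖s - 1‖ * ((C₀ + C₁) * q ^ 4) := by
      refine (norm_add_le _ _).trans ?_
      rw [norm_mul]
      have : ‖riemannZeta₀ s‖ ≤ ‖s - 1‖ * (C₀ * q ^ 4) := by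
        have : 0 ≤ C₀ * q ^ 4 := by positivity
        nlinarith
      have : ‖s - 1‖ * ‖deriv riemannZeta₀ s‖ ≤ ‖s - 1‖ * (C₁ * q ^ 4) := by gcongr
      linarith
    refine k1.trans ?_
    have k2 : (C₀ + C₁) / d * q ^ 20 * (‖s - 1‖ * (d / q ^ 16)) = ‖s - 1‖ * ((C₀ + C₁) * q ^ 4) := by
      field_simp
    rw [← k2]
    gcongr
  have e2 : C₀ * q ^ 4 ≤ C₀ * q ^ 20 := by
    gcongr
    norm_num
  unfold FF
  refine (norm_sub_le _ _).trans ?_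
  rw [norm_neg]
  linarith

lemma Q_pow (t : ℝ) : Q t ^ 140 = (1 + |t|) ^ ((1 : ℝ) / 2) := by
  unfold Q
  rw [← Real.rpow_natCast, ← Real.rpow_mul (by positivity)]
  norm_num

lemma FF6_bound : ∃ C : ℝ, 0 < C ∧ ∀ s : ℂ, 1 ≤ s.re → s.re ≤ 3 / 2 →
    ‖iteratedDeriv 6 FF s‖ ≤ C * (1 + |s.im|) ^ ((1 : ℝ) / 2) := by
  obtain ⟨c, C, hc, hc1, hC, h⟩ := FF_bound
  -- compact part
  obtain ⟨M, hM⟩ : ∃ M : ℝ, ∀ s ∈ Set.Icc (1 : ℝ) (3 / 2) ×ℂ Set.Icc (-2 : ℝ) 2,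
      ‖iteratedDeriv 6 FF s‖ ≤ M := by
    have hK : IsCompact (Set.Icc (1 : ℝ) (3 / 2) ×ℂ Set.Icc (-2 : ℝ) 2) :=
      IsCompact.reProdIm isCompact_Icc isCompact_Icc
    refine hK.exists_bound_of_continuousOn ?_
    intro s hs
    have : AnalyticAt ℂ (iteratedDeriv 6 FF) s := by
      rw [iteratedDeriv_eq_iterate]
      exact (FF_analyticAt (zeta1_ne_zero hs.1.1)).iterated_deriv 6
    exact this.continuousAt.continuousWithinAt
  have hfac : (0 : ℝ) < (Nat.factorial 6 : ℕ) := by positivity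
  set K : ℝ := (Nat.factorial 6 : ℕ) * (C * 2 ^ 20) / (c / 2 ^ 20) ^ 6 with hK
  have hK0 : 0 < K := by positivity
  refine ⟨|M| + K, by positivity, ?_⟩
  intro s hs1 hs2
  have hone : 1 ≤ (1 + |s.im|) ^ ((1 : ℝ) / 2) :=
    Real.one_le_rpow (by linarith [abs_nonneg s.im]) (by norm_num)
  by_cases ht : |s.im| ≤ 2
  · have := hM s ⟨⟨hs1, hs2⟩, abs_le.mp ht⟩
    have h2 := le_abs_self M
    have h3 := abs_nonneg M
    nlinarith
  · push Not at ht
    set q := Q s.im with hq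
    have hq1 : 1 ≤ q := Q_one_le _
    set R := c / (2 * q) ^ 20 with hR
    have hR0 : 0 < R := by positivity
    have hR1 : R ≤ 1 / 280 := by
      have : R ≤ c := div_le_self hc.le (one_le_pow₀ (by linarith))
      linarith
    have hball : ∀ z ∈ Metric.closedBall s R, riemannZeta₁ z ≠ 0 ∧ ‖FF z‖ ≤ C * (2 * q) ^ 20 := by
      intro z hz
      have hz' : ‖z - s‖ ≤ R := by simpa [dist_eq_norm] using hz
      have h1 := (Complex.abs_re_le_norm (z - s)).trans hz'
      have h2 := (Complex.abs_im_le_norm (z - s)).trans hz'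
      rw [Complex.sub_re, abs_le] at h1
      rw [Complex.sub_im] at h2
      have a1 : |z.im| ≤ 2 * |s.im| + 1 := by
        have := abs_sub_abs_le_abs_sub z.im s.im
        linarith
      have a2 : 1 ≤ |z.im| := by
        have := abs_sub_abs_le_abs_sub s.im z.im
        rw [abs_sub_comm] at this
        linarith
      have hQz := Q_le a1
      rw [← hq] at hQz
      have hQz1 := Q_one_le z.im
      have a3 : R ≤ c / Q z.im ^ 20 := by rw [hR]; gcongr
      obtain ⟨b1, b2⟩ := h z a2 (by linarith [h1.1]) (by linarith [h1.2])
      refine ⟨b1, b2.trans ?_⟩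
      gcongr
    have hdiff : DiffContOnCl ℂ FF (Metric.ball s R) := by
      apply DifferentiableOn.diffContOnCl_ball (U := Metric.closedBall s R) _ le_rfl
      intro z hz
      exact (FF_analyticAt (hball z hz).1).differentiableAt.differentiableWithinAt
    have := Complex.norm_iteratedDeriv_le_of_forall_mem_sphere_norm_le 6 hR0 hdiff
      (fun z hz => (hball z (Metric.sphere_subset_closedBall hz)).2)
    refine this.trans ?_
    have e : (Nat.factorial 6 : ℕ) * (C * (2 * q) ^ 20) / R ^ 6 = K * q ^ 140 := by
      rw [hR, hK]
      field_simp
    rw [e, hq, Q_pow]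
    have h3 := abs_nonneg M
    nlinarith

section Part4a
open MeasureTheory Complex Set

noncomputable def KK (s : ℂ) : ℂ := 1 / s - 1 / (s + 1)

lemma KK_eq {s : ℂ} (hs : 1 ≤ s.re) : KK s = 1 / (s * (s + 1)) := by
  have h0 : s ≠ 0 := by rintro rfl; simp at hs; linarith
  have h1 : s + 1 ≠ 0 := by
    intro h
    have := congrArg Complex.re h
    simp at this; linarith
  unfold KK
  field_simp
  ring

lemma KK_bound {σ : ℝ} (hσ : 1 ≤ σ) (t : ℝ) : ‖KK (σ + t * I)‖ ≤ (1 + t ^ 2)⁻¹ := by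
  have hre : ((σ : ℂ) + t * I).re = σ := by simp
  have him : ((σ : ℂ) + t * I).im = t := by simp
  rw [KK_eq (by rw [hre]; exact hσ), norm_div, norm_one, one_div]
  have hp : 0 < 1 + t ^ 2 := by positivity
  apply inv_anti₀ hp
  rw [norm_mul]
  have e1 : √(1 + t ^ 2) ≤ ‖(σ : ℂ) + t * I‖ := by
    rw [Complex.norm_eq_sqrt_sq_add_sq, hre, him]
    apply Real.sqrt_le_sqrt; nlinarith
  have e2 : √(1 + t ^ 2) ≤ ‖(σ : ℂ) + t * I + 1‖ := by
    rw [Complex.norm_eq_sqrt_sq_add_sq]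
    simp
    apply Real.sqrt_le_sqrt; nlinarith
  calc 1 + t ^ 2 = √(1 + t ^ 2) * √(1 + t ^ 2) := (Real.mul_self_sqrt hp.le).symm
    _ ≤ _ := mul_le_mul e1 e2 (Real.sqrt_nonneg _) (norm_nonneg _)

lemma KK_cont {σ : ℝ} (hσ : 1 ≤ σ) : Continuous (fun t : ℝ => KK (σ + t * I)) := by
  unfold KK
  have h0 : ∀ t : ℝ, (σ : ℂ) + t * I ≠ 0 := by
    intro t h
    have := congrArg Complex.re h
    simp at this; linarith
  have h1 : ∀ t : ℝ, (σ : ℂ) + t * I + 1 ≠ 0 := by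
    intro t h
    have := congrArg Complex.re h
    simp at this; linarith
  fun_prop (disch := first | exact h0 | exact h1 | (intro t; first | exact h0 t | exact h1 t))

lemma KK_integrable {σ : ℝ} (hσ : 1 ≤ σ) : Integrable (fun t : ℝ => KK (σ + t * I)) := by
  refine integrable_inv_one_add_sq.mono' (KK_cont hσ).aestronglyMeasurable ?_
  exact Filter.Eventually.of_forall fun t => KK_bound hσ t

noncomputable def gg (t : ℝ) : ℂ :=
  indicator (Ioc 0 1) (fun _ => 1 : ℝ → ℂ) t - indicator (Ioc 0 1) (fun t => (t : ℂ) ^ (1 : ℂ) : ℝ → ℂ) t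

lemma gg_eq {t : ℝ} (ht : 0 < t) : gg t = ((max (1 - t) 0 : ℝ) : ℂ) := by
  unfold gg
  by_cases h : t ≤ 1
  · have : t ∈ Ioc (0:ℝ) 1 := ⟨ht, h⟩
    simp [indicator_of_mem this, max_eq_left (sub_nonneg.2 h)]
  · have h' : t ∉ Ioc (0:ℝ) 1 := fun hh => h hh.2
    push Not at h
    simp [indicator_of_notMem h', max_eq_right (by linarith : 1 - t ≤ 0)]

lemma gg_mellin {s : ℂ} (hs : 1 ≤ s.re) : HasMellin gg s (KK s) := by
  have h1 := hasMellin_one_Ioc (s := s) (by linarith)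
  have h2 := hasMellin_cpow_Ioc (1 : ℂ) (s := s) (by simp; linarith)
  have := hasMellin_sub h1.1 h2.1
  rw [h1.2, h2.2] at this
  exact this

lemma perron_kernel {σ : ℝ} (hσ : 1 ≤ σ) {y : ℝ} (hy : 0 < y) :
    ∫ t : ℝ, (y : ℂ) ^ (-((σ : ℂ) + t * I)) * KK (σ + t * I) =
      2 * π * ((max (1 - y) 0 : ℝ) : ℂ) := by
  have hm : ∀ t : ℝ, mellin gg (σ + t * I) = KK (σ + t * I) := fun t =>
    (gg_mellin (by simpa using hσ)).2
  have hc : ContinuousAt gg y := by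
    have : ContinuousAt (fun t : ℝ => ((max (1 - t) 0 : ℝ) : ℂ)) y := by fun_prop
    apply this.congr
    filter_upwards [lt_mem_nhds hy] with t ht
    exact (gg_eq ht).symm
  have := mellinInv_mellin_eq σ gg hy (gg_mellin (by simpa using hσ)).1 (by
    unfold VerticalIntegrable
    simp_rw [hm]
    exact KK_integrable hσ) hc
  rw [gg_eq hy, mellinInv] at this
  simp_rw [hm, smul_eq_mul] at this
  rw [← this, Complex.real_smul]
  push_cast
  have : (π : ℂ) ≠ 0 := by exact_mod_cast Real.pi_ne_zero
  generalize (∫ t : ℝ, (y : ℂ) ^ (-((σ : ℂ) + t * I)) * KK (σ + t * I)) = J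
  field_simp

lemma perron_sum (c : ℕ → ℂ) (hc0 : c 0 = 0) {σ x : ℝ} (hσ : 1 ≤ σ) (hx : 0 < x)
    (hs : LSeriesSummable c σ) :
    HasSum (fun n : ℕ => c n * (2 * π * ((max (1 - n / x) 0 : ℝ) : ℂ)))
      (∫ t : ℝ, LSeries c (σ + t * I) * (x : ℂ) ^ ((σ : ℂ) + t * I) * KK (σ + t * I)) := by
  set F : ℕ → ℝ → ℂ := fun n t =>
    LSeries.term c (σ + t * I) n * (x : ℂ) ^ ((σ : ℂ) + t * I) * KK (σ + t * I) with hF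
  have hx0 : (x : ℂ) ≠ 0 := by exact_mod_cast hx.ne'
  have hs0 : ∀ t : ℝ, (σ : ℂ) + t * I ≠ 0 := by
    intro t h
    have := congrArg Complex.re h
    simp at this; linarith
  have hterm : ∀ n (t : ℝ), n ≠ 0 → F n t =
      c n * (((n / x : ℝ) : ℂ) ^ (-((σ : ℂ) + t * I)) * KK (σ + t * I)) := by
    intro n t hn
    simp only [hF]
    rw [LSeries.term_of_ne_zero hn]
    have : ((n / x : ℝ) : ℂ) ^ (-((σ : ℂ) + t * I)) =
        (x : ℂ) ^ ((σ : ℂ) + t * I) / (n : ℂ) ^ ((σ : ℂ) + t * I) := by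
      rw [Complex.ofReal_div, Complex.div_cpow_ofReal_nonneg (by positivity) hx.le,
        Complex.cpow_neg, Complex.cpow_neg]
      rw [Complex.ofReal_natCast]
      simp [div_eq_mul_inv, mul_comm]
    rw [this]
    ring
  have hnorm : ∀ n (t : ℝ), ‖F n t‖ ≤ ‖LSeries.term c σ n‖ * x ^ σ * (1 + t ^ 2)⁻¹ := by
    intro n t
    simp only [hF, norm_mul]
    have e1 : ‖LSeries.term c (σ + t * I) n‖ = ‖LSeries.term c σ n‖ := by
      simp [LSeries.norm_term_eq]
    have e2 : ‖(x : ℂ) ^ ((σ : ℂ) + t * I)‖ = x ^ σ := by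
      rw [Complex.norm_cpow_eq_rpow_re_of_pos hx]; simp
    rw [e1, e2]
    exact mul_le_mul_of_nonneg_left (KK_bound hσ t) (by positivity)
  have hcont : ∀ n, Continuous (F n) := by
    intro n
    rcases eq_or_ne n 0 with rfl | hn
    · simp [hF]; exact continuous_const
    · have hn0 : (n : ℂ) ≠ 0 := by exact_mod_cast hn
      have : F n = fun t : ℝ => c n / (n : ℂ) ^ ((σ : ℂ) + t * I) * (x : ℂ) ^ ((σ : ℂ) + t * I) *
          KK (σ + t * I) := by
        funext t; simp only [hF]; rw [LSeries.term_of_ne_zero hn]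
      rw [this]
      refine ((continuous_const.div ?_ ?_).mul ?_).mul (KK_cont hσ)
      · exact Continuous.const_cpow (by fun_prop) (Or.inl hn0)
      · intro t; simp [Complex.cpow_eq_zero_iff, hn0]
      · exact Continuous.const_cpow (by fun_prop) (Or.inl hx0)
  have hFint : ∀ n, Integrable (F n) := by
    intro n
    refine (integrable_inv_one_add_sq.const_mul (‖LSeries.term c σ n‖ * x ^ σ)).mono'
      (hcont n).aestronglyMeasurable ?_
    exact Filter.Eventually.of_forall fun t => hnorm n t
  have hsum : Summable fun n => ∫ t, ‖F n t‖ := by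
    have hS : Summable fun n => ‖LSeries.term c σ n‖ * x ^ σ * ∫ t : ℝ, (1 + t ^ 2)⁻¹ :=
      (hs.norm.mul_right _).mul_right _
    refine Summable.of_nonneg_of_le (fun n => integral_nonneg fun t => norm_nonneg _) ?_ hS
    intro n
    rw [← integral_const_mul]
    exact integral_mono (hFint n).norm (integrable_inv_one_add_sq.const_mul _) (hnorm n)
  have key := hasSum_integral_of_summable_integral_norm hFint hsum
  have e1 : (fun n : ℕ => c n * (2 * π * ((max (1 - n / x) 0 : ℝ) : ℂ))) =
      fun n => ∫ t, F n t := by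
    funext n
    rcases eq_or_ne n 0 with rfl | hn
    · simp [hF, hc0]
    · rw [← perron_kernel hσ (y := n / x) (by positivity), ← integral_const_mul]
      congr 1; funext t
      rw [hterm n t hn]
  have e2 : (∫ t : ℝ, LSeries c (σ + t * I) * (x : ℂ) ^ ((σ : ℂ) + t * I) * KK (σ + t * I)) =
      ∫ t, ∑' n, F n t := by
    congr 1; funext t
    simp only [hF]
    rw [tsum_mul_right, tsum_mul_right]
    rfl
  rw [e1, e2]
  exact key

end Part4a

section Part4b
open MeasureTheory Complex Set
open scoped ArithmeticFunction.vonMangoldt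

noncomputable def fL : ℕ → ℂ := (fun n => ((Λ n : ℝ) : ℂ)) - 1

lemma fL_LSeries {s : ℂ} (hs : 1 < s.re) : LSeriesSummable fL s ∧ LSeries fL s = FF s := by
  have h1 := ArithmeticFunction.LSeriesSummable_vonMangoldt hs
  have h2 : LSeriesSummable 1 s := LSeriesSummable_one_iff.2 hs
  refine ⟨h1.sub h2, ?_⟩
  have hs1 : s ≠ 1 := by rintro rfl; simp at hs
  have hs1' : s - 1 ≠ 0 := sub_ne_zero.2 hs1
  have hz : riemannZeta₁ s ≠ 0 := zeta1_ne_zero hs.le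
  rw [fL, LSeries_sub h1 h2, ArithmeticFunction.LSeries_vonMangoldt_eq_deriv_riemannZeta_div hs,
    LSeries_one_eq_riemannZeta hs, FF, deriv_riemannZeta_eq_neg_inv_sub_sq_mul_add hs1]
  have h0 : riemannZeta s = riemannZeta₁ s / (s - 1) := by
    rw [zeta1_eq hs1]; field_simp
  have h3 : riemannZeta₁ s = 1 + (s - 1) * riemannZeta₀ s := by
    rfl
  have h4 : riemannZeta₀ s = (riemannZeta₁ s - 1) / (s - 1) := by
    rw [h3]; field_simp; ring
  rw [h0, h4]
  field_simp
  ring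

lemma fL_abscissa : LSeries.abscissaOfAbsConv fL ≤ 1 := by
  apply LSeries.abscissaOfAbsConv_le_of_forall_lt_LSeriesSummable
  intro y hy
  exact (fL_LSeries (by simpa using hy)).1

noncomputable def cL : ℕ → ℂ := LSeries.logMul^[6] fL

lemma cL_eq (n : ℕ) : cL n = (((Λ n - 1) * Real.log n ^ 6 : ℝ) : ℂ) := by
  simp only [cL, Function.iterate_succ, Function.iterate_zero, Function.comp, LSeries.logMul, fL,
    id, Pi.sub_apply, Pi.one_apply]
  rw [← Complex.natCast_log]
  push_cast
  ring

lemma cL_LSeries {s : ℂ} (hs : 1 < s.re) :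
    LSeriesSummable cL s ∧ LSeries cL s = iteratedDeriv 6 FF s := by
  have ha : LSeries.abscissaOfAbsConv fL < s.re :=
    lt_of_le_of_lt fL_abscissa (by exact_mod_cast hs)
  constructor
  · apply LSeriesSummable_of_abscissaOfAbsConv_lt_re
    rw [cL, LSeries.absicssaOfAbsConv_logPowMul]
    exact ha
  · have : LSeries fL =ᶠ[nhds s] FF := by
      filter_upwards [(isOpen_lt continuous_const continuous_re).mem_nhds hs] with z hz
      exact (fL_LSeries hz).2
    rw [← this.iteratedDeriv_eq, LSeries_iteratedDeriv 6 ha, cL]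
    norm_num

lemma w_integrable : Integrable (fun t : ℝ => (1 + |t|) ^ ((1 : ℝ) / 2) * (1 + t ^ 2)⁻¹) := by
  have h := integrable_rpow_neg_one_add_norm_sq (E := ℝ) (μ := volume) (r := 3 / 2) (by simp; norm_num)
  refine (h.const_mul 2).mono' ?_ ?_
  · apply Continuous.aestronglyMeasurable
    refine Continuous.mul (Continuous.rpow_const (by fun_prop) (by intro t; right; norm_num)) ?_
    exact Continuous.inv₀ (by fun_prop) (fun t => by positivity)
  · refine Filter.Eventually.of_forall fun t => ?_
    have hp : 0 < 1 + t ^ 2 := by positivity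
    rw [Real.norm_of_nonneg (by positivity)]
    have e : (1 + |t|) ^ ((1 : ℝ) / 2) ≤ 2 * (1 + t ^ 2) ^ ((1 : ℝ) / 4) := by
      have h1 : (1 + |t|) ≤ 2 * (1 + t ^ 2) ^ ((1 : ℝ) / 2) := by
        rw [← Real.sqrt_eq_rpow]
        have a1 : 1 ≤ √(1 + t ^ 2) := by
          rw [Real.one_le_sqrt]; nlinarith
        have a2 : |t| ≤ √(1 + t ^ 2) := Real.abs_le_sqrt (by linarith)
        linarith
      calc (1 + |t|) ^ ((1 : ℝ) / 2) ≤ (2 * (1 + t ^ 2) ^ ((1 : ℝ) / 2)) ^ ((1 : ℝ) / 2) :=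
            Real.rpow_le_rpow (by positivity) h1 (by norm_num)
        _ = 2 ^ ((1:ℝ)/2) * (1 + t ^ 2) ^ ((1 : ℝ) / 4) := by
            rw [Real.mul_rpow (by norm_num) (by positivity), ← Real.rpow_mul hp.le]
            norm_num
        _ ≤ _ := by
            apply mul_le_mul_of_nonneg_right _ (by positivity)
            calc (2:ℝ) ^ ((1:ℝ)/2) ≤ 2 ^ (1:ℝ) :=
                  Real.rpow_le_rpow_of_exponent_le (by norm_num) (by norm_num)
              _ = 2 := by norm_num
    calc (1 + |t|) ^ ((1 : ℝ) / 2) * (1 + t ^ 2)⁻¹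
        ≤ 2 * (1 + t ^ 2) ^ ((1 : ℝ) / 4) * (1 + t ^ 2)⁻¹ :=
          mul_le_mul_of_nonneg_right e (by positivity)
      _ = 2 * ((1 + t ^ 2) ^ ((1 : ℝ) / 4) * (1 + t ^ 2) ^ (-1 : ℝ)) := by
          rw [Real.rpow_neg_one]; ring
      _ = 2 * (1 + ‖t‖ ^ 2) ^ (-(3 / 2 : ℝ) / 2) := by
          rw [← Real.rpow_add hp]; norm_num
      _ ≤ _ := le_refl _

lemma smooth_bound : ∃ C : ℝ, 0 < C ∧ ∀ x : ℝ, 8 ≤ x → ∀ N : ℕ, x ≤ N →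
    |∑ n ∈ Finset.range N, (Λ n - 1) * Real.log n ^ 6 * max (1 - n / x) 0| ≤ C * x := by
  obtain ⟨C, hC, hFF⟩ := FF6_bound
  set J : ℝ := ∫ t : ℝ, (1 + |t|) ^ ((1 : ℝ) / 2) * (1 + t ^ 2)⁻¹ with hJ
  have hJ0 : 0 ≤ J := integral_nonneg fun t => by positivity
  refine ⟨C * J * Real.exp 1 + 1, by positivity, ?_⟩
  intro x hx N hN
  have hx0 : 0 < x := by linarith
  have hlog : 2 ≤ Real.log x := by
    rw [Real.le_log_iff_exp_le hx0]
    have := Real.exp_one_lt_d9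
    have h2 : Real.exp 2 = Real.exp 1 * Real.exp 1 := by rw [← Real.exp_add]; norm_num
    nlinarith [Real.exp_pos 1]
  set σ : ℝ := 1 + 1 / Real.log x with hσ
  have hinv : 0 < 1 / Real.log x := by positivity
  have hinv2 : 1 / Real.log x ≤ 1 / 2 := one_div_le_one_div_of_le (by norm_num) hlog
  have hσ1 : 1 < σ := by linarith
  have hxσ : x ^ σ = x * Real.exp 1 := by
    rw [hσ, Real.rpow_add hx0, Real.rpow_one, Real.rpow_def_of_pos hx0]
    congr 2; field_simp
  have hsum := perron_sum cL (by rw [cL_eq]; simp) hσ1.le hx0 (cL_LSeries (by simpa using hσ1)).1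
  set E : ℂ := ∫ t : ℝ, LSeries cL (σ + t * I) * (x : ℂ) ^ ((σ : ℂ) + t * I) * KK (σ + t * I)
    with hE
  have hEb : ‖E‖ ≤ C * (x * Real.exp 1) * J := by
    rw [hJ, ← integral_const_mul]
    refine norm_integral_le_of_norm_le (w_integrable.const_mul _) ?_
    refine Filter.Eventually.of_forall fun t => ?_
    have hre : ((σ : ℂ) + t * I).re = σ := by simp
    have him : ((σ : ℂ) + t * I).im = t := by simp
    rw [norm_mul, norm_mul, (cL_LSeries (by rw [hre]; exact hσ1)).2,
      Complex.norm_cpow_eq_rpow_re_of_pos hx0, hre, hxσ]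
    have b1 := hFF (σ + t * I) (by rw [hre]; exact hσ1.le) (by rw [hre]; linarith)
    rw [him] at b1
    calc _ ≤ C * (1 + |t|) ^ ((1 : ℝ) / 2) * (x * Real.exp 1) * (1 + t ^ 2)⁻¹ := by
          apply mul_le_mul _ (KK_bound hσ1.le t) (norm_nonneg _) (by positivity)
          exact mul_le_mul_of_nonneg_right b1 (by positivity)
      _ = _ := by ring
  have hfin : E = ∑ n ∈ Finset.range N, cL n * (2 * π * ((max (1 - n / x) 0 : ℝ) : ℂ)) := by
    rw [← hsum.tsum_eq]
    apply tsum_eq_sum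
    intro n hn
    have hn' : (N : ℝ) ≤ n := by
      simp only [Finset.mem_range, not_lt] at hn
      exact_mod_cast hn
    have : max (1 - (n : ℝ) / x) 0 = 0 := by
      apply max_eq_right
      rw [sub_nonpos, one_le_div hx0]; linarith
    rw [this]; simp
  have hfin2 : E = ((2 * π * ∑ n ∈ Finset.range N,
      (Λ n - 1) * Real.log n ^ 6 * max (1 - n / x) 0 : ℝ) : ℂ) := by
    rw [hfin, Finset.mul_sum]
    push_cast
    apply Finset.sum_congr rfl
    intro n _
    rw [cL_eq]
    push_cast
    ring
  rw [hfin2, Complex.norm_real, Real.norm_eq_abs, abs_mul, abs_of_pos (by positivity : 0 < 2 * π)] at hEb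
  set S := |∑ n ∈ Finset.range N, (Λ n - 1) * Real.log n ^ 6 * max (1 - n / x) 0| with hS
  have hS0 : 0 ≤ S := abs_nonneg _
  have : S ≤ 2 * π * S := by nlinarith [Real.pi_gt_three]
  nlinarith

end Part4b

section Part5
open scoped ArithmeticFunction.vonMangoldt

lemma log_cube_le {x : ℝ} (hx : 1 ≤ x) : Real.log x ^ 3 ≤ 6 * x := by
  have h0 : 0 ≤ Real.log x := Real.log_nonneg hx
  have := Real.pow_div_factorial_le_exp (Real.log x) h0 3
  rw [Real.exp_log (by linarith)] at this
  norm_num [Nat.factorial] at this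
  linarith

lemma c_lower {n N : ℕ} (h : n < N) : -(Real.log N ^ 6) ≤ (Λ n - 1) * Real.log n ^ 6 := by
  have h1 : 0 ≤ Λ n := ArithmeticFunction.vonMangoldt_nonneg
  have h2 : 0 ≤ Real.log n := Real.log_natCast_nonneg n
  have h3 : Real.log n ≤ Real.log N := by
    rcases Nat.eq_zero_or_pos n with rfl | hn
    · simpa using Real.log_natCast_nonneg N
    · exact Real.log_le_log (by exact_mod_cast hn) (by exact_mod_cast h.le)
  have h4 : Real.log n ^ 6 ≤ Real.log N ^ 6 := pow_le_pow_left₀ h2 h3 6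
  have h5 : 0 ≤ Real.log n ^ 6 := by positivity
  nlinarith [mul_nonneg h1 h5]

lemma A_lower : ∃ C : ℝ, 0 < C ∧ ∀ N : ℕ,
    -(C * (N * Real.log N ^ 3)) ≤ ∑ n ∈ Finset.range N, (Λ n - 1) * Real.log n ^ 6 := by
  obtain ⟨C, hC, hS⟩ := smooth_bound
  refine ⟨2 * C + 34, by linarith, ?_⟩
  intro N
  rcases Nat.lt_or_ge N 16 with hN | hN
  · -- small case
    rcases Nat.eq_zero_or_pos N with rfl | hpos
    · simp
    have hN1 : (1 : ℝ) ≤ N := by exact_mod_cast hpos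
    have hL0 : 0 ≤ Real.log N := Real.log_natCast_nonneg N
    have hL3 : Real.log N ≤ 3 := by
      rw [Real.log_le_iff_le_exp (by linarith)]
      have : (N : ℝ) ≤ 16 := by exact_mod_cast hN.le
      have h2 : Real.exp 3 = Real.exp 1 ^ 3 := by rw [← Real.exp_nat_mul]; norm_num
      have h3 : (2.7:ℝ) ^ 3 ≤ Real.exp 1 ^ 3 :=
        pow_le_pow_left₀ (by norm_num) (by linarith [Real.exp_one_gt_d9]) 3
      rw [h2]; norm_num at h3; linarith
    have h1 : ∑ n ∈ Finset.range N, (-(Real.log N ^ 6)) ≤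
        ∑ n ∈ Finset.range N, (Λ n - 1) * Real.log n ^ 6 :=
      Finset.sum_le_sum fun n hn => c_lower (Finset.mem_range.1 hn)
    rw [Finset.sum_const, Finset.card_range, nsmul_eq_mul] at h1
    have h2 : Real.log N ^ 3 ≤ 3 ^ 3 := pow_le_pow_left₀ hL0 hL3 3
    have h3 : 0 ≤ Real.log N ^ 3 := by positivity
    have h4 : Real.log N ^ 6 = Real.log N ^ 3 * Real.log N ^ 3 := by ring
    rw [h4] at h1
    have h5 : 0 ≤ (N : ℝ) * Real.log N ^ 3 := by positivity
    have h6 : (N : ℝ) * Real.log N ^ 3 * Real.log N ^ 3 ≤ N * Real.log N ^ 3 * 3 ^ 3 :=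
      mul_le_mul_of_nonneg_left h2 h5
    nlinarith [mul_nonneg hC.le h5]
  · have hN16 : (16 : ℝ) ≤ N := by exact_mod_cast hN
    have hN0 : (0 : ℝ) < N := by linarith
    set L := Real.log N with hL
    have hL2 : 2 ≤ L := by
      rw [hL, Real.le_log_iff_exp_le hN0]
      have := Real.exp_one_lt_d9
      have h2 : Real.exp 2 = Real.exp 1 * Real.exp 1 := by rw [← Real.exp_add]; norm_num
      nlinarith [Real.exp_pos 1]
    have hL8 : 8 ≤ L ^ 3 := by
      calc (8:ℝ) = 2 ^ 3 := by norm_num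
        _ ≤ _ := pow_le_pow_left₀ (by norm_num) hL2 3
    set δ : ℝ := (L ^ 3)⁻¹ with hδ
    have hL3pos : 0 < L ^ 3 := by linarith
    have hδ0 : 0 < δ := by positivity
    have hδL : δ * L ^ 3 = 1 := inv_mul_cancel₀ hL3pos.ne'
    have hδ8 : δ ≤ 1 / 8 := by
      rw [hδ, one_div]; exact inv_anti₀ (by norm_num) hL8
    set x' : ℝ := N * (1 - δ) with hx'
    have hx'8 : 8 ≤ x' := by nlinarith
    have hx'N : x' ≤ N := by nlinarith
    have hx'0 : 0 < x' := by linarith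
    have S1 := hS N (by linarith) N le_rfl
    have S2 := hS x' hx'8 N hx'N
    set c : ℕ → ℝ := fun n => (Λ n - 1) * Real.log n ^ 6 with hc
    have S1' : |∑ n ∈ Finset.range N, c n * max (1 - n / (N:ℝ)) 0| ≤ C * N := S1
    have S2' : |∑ n ∈ Finset.range N, c n * max (1 - n / x') 0| ≤ C * x' := S2
    clear S1 S2
    change _ ≤ ∑ n ∈ Finset.range N, c n
    -- identity
    have hid : δ * N * ∑ n ∈ Finset.range N, c n =
        N * (∑ n ∈ Finset.range N, c n * max (1 - n / (N:ℝ)) 0)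
        - x' * (∑ n ∈ Finset.range N, c n * max (1 - n / x') 0)
        + ∑ n ∈ Finset.range N, c n * max (n - x') 0 := by
      rw [Finset.mul_sum, Finset.mul_sum, Finset.mul_sum, ← Finset.sum_sub_distrib,
        ← Finset.sum_add_distrib]
      apply Finset.sum_congr rfl
      intro n hn
      have hnN : (n : ℝ) ≤ N := by exact_mod_cast (Finset.mem_range.1 hn).le
      have m1 : max (1 - n / (N:ℝ)) 0 = 1 - n / N := by
        apply max_eq_left; rw [sub_nonneg, div_le_one hN0]; exact hnN
      rw [m1]
      rcases le_total (n : ℝ) x' with h | h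
      · have m2 : max (1 - n / x') 0 = 1 - n / x' := by
          apply max_eq_left; rw [sub_nonneg, div_le_one hx'0]; exact h
        have m3 : max ((n:ℝ) - x') 0 = 0 := max_eq_right (by linarith)
        rw [m2, m3]
        have e1 : (N:ℝ) * (c n * (1 - n / N)) = c n * (N - n) := by field_simp
        have e2 : x' * (c n * (1 - n / x')) = c n * (x' - n) := by field_simp
        rw [e1, e2, hx']; ring
      · have m2 : max (1 - n / x') 0 = 0 := by
          apply max_eq_right; rw [sub_nonpos, one_le_div hx'0]; exact h
        have m3 : max ((n:ℝ) - x') 0 = n - x' := max_eq_left (by linarith)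
        rw [m2, m3]
        have e1 : (N:ℝ) * (c n * (1 - n / N)) = c n * (N - n) := by field_simp
        rw [e1, hx']; ring
    have hlast : -((δ * N + 1) * (δ * N * L ^ 6)) ≤
        ∑ n ∈ Finset.range N, c n * max (n - x') 0 := by
      have hsub : ∑ n ∈ Finset.Ico ⌈x'⌉₊ N, c n * max (n - x') 0 =
          ∑ n ∈ Finset.range N, c n * max (n - x') 0 := by
        apply Finset.sum_subset
        · intro n hn; simp only [Finset.mem_Ico] at hn; simpa using hn.2
        · intro n hn hn2
          simp only [Finset.mem_Ico, Finset.mem_range, not_and, not_lt] at hn hn2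
          have : n < ⌈x'⌉₊ := by
            by_contra hh; push Not at hh; exact absurd (hn2 hh) (by omega)
          have : (n : ℝ) < x' := Nat.lt_ceil.1 this
          rw [max_eq_right (by linarith), mul_zero]
      rw [← hsub]
      have hb : ∑ n ∈ Finset.Ico ⌈x'⌉₊ N, (-(δ * N * L ^ 6)) ≤
          ∑ n ∈ Finset.Ico ⌈x'⌉₊ N, c n * max (n - x') 0 := by
        apply Finset.sum_le_sum
        intro n hn
        simp only [Finset.mem_Ico] at hn
        have h1 : -(L ^ 6) ≤ c n := c_lower hn.2
        have h2 : (n : ℝ) ≤ N := by exact_mod_cast hn.2.le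
        have h3 : max ((n:ℝ) - x') 0 ≤ δ * N := by
          apply max_le _ (by positivity); rw [hx']; nlinarith
        have h4 : 0 ≤ max ((n:ℝ) - x') 0 := le_max_right _ _
        have h5 : 0 ≤ L ^ 6 := by positivity
        nlinarith [mul_le_mul_of_nonneg_right h1 h4, mul_le_mul_of_nonneg_right h3 h5]
      rw [Finset.sum_const, Nat.card_Ico, nsmul_eq_mul] at hb
      refine le_trans ?_ hb
      have hcard : ((N - ⌈x'⌉₊ : ℕ) : ℝ) ≤ δ * N + 1 := by
        have hle : ⌈x'⌉₊ ≤ N := Nat.ceil_le.2 hx'N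
        rw [Nat.cast_sub hle]
        have := Nat.le_ceil x'
        rw [hx'] at this ⊢
        nlinarith
      have h5 : 0 ≤ δ * N * L ^ 6 := by positivity
      nlinarith [mul_le_mul_of_nonneg_right hcard h5]
    have b1 := (abs_le.1 S1').1
    have b2 := (abs_le.1 S2').2
    set X := ∑ n ∈ Finset.range N, c n * max (1 - n / (N:ℝ)) 0
    set Y := ∑ n ∈ Finset.range N, c n * max (1 - n / x') 0
    set Z := ∑ n ∈ Finset.range N, c n * max ((n:ℝ) - x') 0
    set A := ∑ n ∈ Finset.range N, c n
    have c1 : -(C * N * N) ≤ N * X := by nlinarith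
    have c2 : x' * Y ≤ C * N * N := by
      have : x' * Y ≤ x' * (C * x') := mul_le_mul_of_nonneg_left b2 hx'0.le
      have : x' * x' ≤ N * N := mul_le_mul hx'N hx'N hx'0.le hN0.le
      nlinarith
    have c3 : -(2 * C * N * N) - (δ * N + 1) * (δ * N * L ^ 6) ≤ δ * N * A := by
      rw [hid]; linarith
    -- multiply by L^3 / N
    have hcube : L ^ 3 ≤ 6 * N := log_cube_le (by linarith)
    have c4 : δ * N * (-((2 * C + 34) * (N * L ^ 3))) ≤ δ * N * A := by
      refine le_trans ?_ c3
      have e1 : δ * N * (-((2 * C + 34) * (N * L ^ 3))) = -((2 * C + 34) * N * N) := by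
        calc _ = -((2 * C + 34) * N * N) * (δ * L ^ 3) := by ring
          _ = _ := by rw [hδL, mul_one]
      have e2 : (δ * N + 1) * (δ * N * L ^ 6) = N * N + N * L ^ 3 := by
        calc _ = (δ * L ^ 3) * (δ * L ^ 3) * (N * N) + (δ * L ^ 3) * (N * L ^ 3) := by ring
          _ = _ := by rw [hδL]; ring
      rw [e1, e2]
      nlinarith
    exact le_of_mul_le_mul_left c4 (by positivity)

lemma abel_nonneg (u g : ℕ → ℝ) (hu : ∀ N, 0 ≤ ∑ n ∈ Finset.range N, u n)
    (hg : Antitone g) (hg0 : ∀ n, 0 ≤ g n) (N : ℕ) :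
    0 ≤ ∑ n ∈ Finset.range N, u n * g n := by
  have key : ∀ N, g N * ∑ n ∈ Finset.range (N + 1), u n ≤
      ∑ n ∈ Finset.range (N + 1), u n * g n := by
    intro N
    induction N with
    | zero => simp [mul_comm]
    | succ k ih =>
      rw [Finset.sum_range_succ, Finset.sum_range_succ _ (k + 1)]
      have h1 : g (k + 1) ≤ g k := hg (Nat.le_succ k)
      have := mul_le_mul_of_nonneg_right h1 (hu (k + 1))
      nlinarith
  rcases N with _ | k
  · simp
  · exact le_trans (mul_nonneg (hg0 k) (hu _)) (key k)

lemma log_nat_ge {n : ℕ} (hn : 2 ≤ n) : 2 / 3 ≤ Real.log n := by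
  have : Real.log 2 ≤ Real.log n := Real.log_le_log (by norm_num) (by exact_mod_cast hn)
  linarith [Real.log_two_gt_d9]

lemma d_bound {n : ℕ} (hn : 2 ≤ n) :
    ((n + 1 : ℕ) : ℝ) * Real.log (n + 1 : ℕ) ^ 3 - n * Real.log n ^ 3 ≤ 26 * Real.log n ^ 3 := by
  have hn2 : (2 : ℝ) ≤ n := by exact_mod_cast hn
  have hn0 : (0 : ℝ) < n := by linarith
  have hL := log_nat_ge hn
  push_cast
  set b := Real.log n with hb
  set a := Real.log ((n : ℝ) + 1) with ha
  have h1 : b ≤ a := Real.log_le_log hn0 (by linarith)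
  have h2 : n * (a - b) ≤ 1 := by
    have : a - b = Real.log (1 + 1 / n) := by
      rw [ha, hb, ← Real.log_div (by positivity) (by positivity)]
      congr 1; field_simp
    have h3 : Real.log (1 + 1 / (n:ℝ)) ≤ 1 / n := by
      have := Real.log_le_sub_one_of_pos (x := 1 + 1 / (n:ℝ)) (by positivity)
      linarith
    rw [this]
    calc (n:ℝ) * Real.log (1 + 1 / n) ≤ n * (1 / n) := mul_le_mul_of_nonneg_left h3 hn0.le
      _ = 1 := by field_simp
  have h3 : a ≤ 2 * b := by
    rw [ha, hb, ← Real.log_rpow hn0]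
    apply Real.log_le_log (by linarith)
    norm_num; nlinarith
  have hb0 : 0 < b := by linarith
  have ha0 : 0 < a := by linarith
  have e1 : a ^ 3 ≤ 8 * b ^ 3 := by
    calc a ^ 3 ≤ (2 * b) ^ 3 := pow_le_pow_left₀ ha0.le h3 3
      _ = _ := by ring
  have e2 : a ^ 2 ≤ 4 * b ^ 2 := by nlinarith
  have e3 : n * (a - b) * (a ^ 2 + a * b + b ^ 2) ≤ 1 * (a ^ 2 + a * b + b ^ 2) :=
    mul_le_mul_of_nonneg_right h2 (by positivity)
  have e4 : a ^ 2 + a * b + b ^ 2 ≤ 12 * b ^ 2 := by nlinarith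
  have e5 : 12 * b ^ 2 ≤ 18 * b ^ 3 := by nlinarith [sq_nonneg b]
  nlinarith

lemma pi_sum_lower : ∃ K : ℝ, 0 < K ∧ ∀ N : ℕ,
    ∑ n ∈ Finset.Ico 2 N, (1 / Real.log n - K / Real.log n ^ 4) - K ≤
      ∑ n ∈ Finset.Ico 2 N, Λ n / Real.log n := by
  obtain ⟨C, hC, hA⟩ := A_lower
  set g : ℕ → ℝ := fun n => 1 / Real.log (max n 2 : ℕ) ^ 7 with hg
  have hlog : ∀ n : ℕ, 0 < Real.log (max n 2 : ℕ) := fun n => by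
    have := log_nat_ge (le_max_right n 2); linarith
  have hganti : Antitone g := by
    intro m n hmn
    apply one_div_le_one_div_of_le (pow_pos (hlog m) 7)
    apply pow_le_pow_left₀ (hlog m).le
    apply Real.log_le_log
    · have : 0 < max m 2 := by omega
      exact_mod_cast this
    · have : max m 2 ≤ max n 2 := by omega
      exact_mod_cast this
  have hg0 : ∀ n, 0 ≤ g n := fun n => (one_div_pos.2 (pow_pos (hlog n) 7)).le
  set d : ℕ → ℝ := fun n => ((n + 1 : ℕ) : ℝ) * Real.log (n + 1 : ℕ) ^ 3 - n * Real.log n ^ 3 with hd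
  set u : ℕ → ℝ := fun n => (Λ n - 1) * Real.log n ^ 6 + C * d n with hu
  have husum : ∀ N, 0 ≤ ∑ n ∈ Finset.range N, u n := by
    intro N
    simp only [hu]
    rw [Finset.sum_add_distrib, ← Finset.mul_sum]
    have : ∑ n ∈ Finset.range N, d n = N * Real.log N ^ 3 := by
      have := Finset.sum_range_sub (fun n : ℕ => (n : ℝ) * Real.log n ^ 3) N
      simp only [hd]
      rw [this]; simp
    rw [this]
    linarith [hA N]
  have habel := abel_nonneg u g husum hganti hg0
  set K0 : ℝ := |u 0 * g 0 + u 1 * g 1| with hK0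
  refine ⟨26 * C + K0, by positivity, ?_⟩
  intro N
  rcases Nat.lt_or_ge N 2 with hN | hN
  · rw [Finset.Ico_eq_empty (by omega)]
    have hpos : 0 ≤ 26 * C + K0 := by positivity
    rw [Finset.sum_empty, Finset.sum_empty]
    linarith
  have h1 := habel N
  have hsplit : ∑ n ∈ Finset.range N, u n * g n =
      (u 0 * g 0 + u 1 * g 1) + ∑ n ∈ Finset.Ico 2 N, u n * g n := by
    rw [← Finset.sum_range_add_sum_Ico _ hN]
    simp [Finset.sum_range_succ]
  rw [hsplit] at h1
  have h2 : ∑ n ∈ Finset.Ico 2 N, u n * g n ≤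
      ∑ n ∈ Finset.Ico 2 N, (Λ n / Real.log n -
        (1 / Real.log n - (26 * C + K0) / Real.log n ^ 4)) := by
    apply Finset.sum_le_sum
    intro n hn
    have hn2 : 2 ≤ n := (Finset.mem_Ico.1 hn).1
    have hL := log_nat_ge hn2
    have hgn : g n = 1 / Real.log n ^ 7 := by
      simp only [hg]; rw [max_eq_left hn2]
    have hdn : d n ≤ 26 * Real.log n ^ 3 := d_bound hn2
    rw [hgn]
    simp only [hu]
    set b := Real.log n
    have hb : 0 < b := by linarith
    have e1 : ((Λ n - 1) * b ^ 6 + C * d n) * (1 / b ^ 7) ≤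
        ((Λ n - 1) * b ^ 6 + (26 * C + K0) * b ^ 3) * (1 / b ^ 7) := by
      apply mul_le_mul_of_nonneg_right _ (by positivity)
      have : 0 ≤ K0 * b ^ 3 := by positivity
      nlinarith [mul_le_mul_of_nonneg_left hdn hC.le]
    refine e1.trans (le_of_eq ?_)
    field_simp
    ring
  rw [Finset.sum_sub_distrib] at h2
  have h3 := le_abs_self (u 0 * g 0 + u 1 * g 1)
  rw [← hK0] at h3
  linarith

end Part5

section Part6
open scoped ArithmeticFunction.vonMangoldt

noncomputable def HH (u : ℝ) : ℝ :=
  u / Real.log u + u / Real.log u ^ 2 + u / Real.log u ^ 3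

lemma HH_deriv {u : ℝ} (hu : 1 < u) : HasDerivAt HH
    (1 / Real.log u - 1 / Real.log u ^ 3 - 3 / Real.log u ^ 4) u := by
  have hL : 0 < Real.log u := Real.log_pos hu
  have hu0 : u ≠ 0 := by linarith
  have hl := Real.hasDerivAt_log hu0
  have h1 := (hasDerivAt_id u).div hl hL.ne'
  have h2 := (hasDerivAt_id u).div (hl.pow 2) (pow_pos hL 2).ne'
  have h3 := (hasDerivAt_id u).div (hl.pow 3) (pow_pos hL 3).ne'
  have h4 : HasDerivAt HH _ u := (h1.add h2).add h3
  refine h4.congr_deriv ?_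
  simp only [id, Pi.pow_apply]
  field_simp
  push_cast
  ring

lemma HH_step {m : ℕ} {K : ℝ} (hm2 : 2 ≤ Real.log m) (hmK : K ≤ Real.log m) :
    HH ((m + 1 : ℕ) : ℝ) - HH m ≤ 1 / Real.log m - K / Real.log m ^ 4 := by
  have hm1 : (1 : ℝ) < m := by
    by_contra h
    push Not at h
    have := Real.log_nonpos (Nat.cast_nonneg m) h
    linarith
  have hlt : (m : ℝ) < (m + 1 : ℕ) := by push_cast; linarith
  obtain ⟨v, hv, hve⟩ := exists_hasDerivAt_eq_slope HH
    (fun u => 1 / Real.log u - 1 / Real.log u ^ 3 - 3 / Real.log u ^ 4) hlt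
    (fun u hu => (HH_deriv (lt_of_lt_of_le hm1 hu.1)).continuousAt.continuousWithinAt)
    (fun u hu => HH_deriv (hm1.trans hu.1))
  have e1 : HH ((m + 1 : ℕ) : ℝ) - HH m =
      1 / Real.log v - 1 / Real.log v ^ 3 - 3 / Real.log v ^ 4 := by
    rw [hve]
    have : (((m + 1 : ℕ) : ℝ) - m) = 1 := by push_cast; ring
    rw [this, div_one]
  rw [e1]
  have hlv : Real.log m ≤ Real.log v := Real.log_le_log (by linarith) hv.1.le
  set b := Real.log m
  set w := Real.log v
  have hb : 0 < b := by linarith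
  have hw : 0 < w := by linarith
  have i1 : 1 / w ≤ 1 / b := one_div_le_one_div_of_le hb hlv
  have i2 : 1 / b ≤ 1 / 2 := one_div_le_one_div_of_le (by norm_num) hm2
  have i3 : 0 < 1 / w := by positivity
  have i4 : 0 < 3 / w ^ 4 := by positivity
  have i5 : K / b ^ 4 ≤ 1 / b ^ 3 := by
    rw [div_le_div_iff₀ (by positivity) (by positivity)]
    nlinarith [pow_pos hb 3]
  have j1 : 1 / w ^ 3 = (1 / w) ^ 3 := by rw [one_div_pow]
  have j2 : 1 / b ^ 3 = (1 / b) ^ 3 := by rw [one_div_pow]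
  have : 1 / w - 1 / w ^ 3 ≤ 1 / b - 1 / b ^ 3 := by
    rw [j1, j2]
    set s := 1 / w
    set r := 1 / b
    have hr : 0 < r := by linarith
    have : 0 ≤ (r - s) * (1 - (r ^ 2 + r * s + s ^ 2)) := by
      apply mul_nonneg (by linarith)
      nlinarith
    nlinarith
  linarith

lemma sum_lower : ∃ (K : ℝ) (M : ℕ), 0 < K ∧ ∀ N : ℕ, M ≤ N →
    HH N - K ≤ ∑ n ∈ Finset.Ico 2 N, Λ n / Real.log n := by
  obtain ⟨K, hK, hs⟩ := pi_sum_lower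
  have ht : Tendsto (fun n : ℕ => Real.log n) atTop atTop :=
    Real.tendsto_log_atTop.comp tendsto_natCast_atTop_atTop
  obtain ⟨M0, hM0⟩ := eventually_atTop.1 (ht.eventually_ge_atTop (max 2 K))
  set M := max M0 2 with hM
  set B : ℝ := ∑ n ∈ Finset.Ico 2 M, (1 / Real.log n - K / Real.log n ^ 4) with hB
  refine ⟨K + |HH M| + |B|, M, by positivity, ?_⟩
  intro N hN
  have h1 : HH N - HH M ≤ ∑ n ∈ Finset.Ico M N, (1 / Real.log n - K / Real.log n ^ 4) := by
    rw [← Finset.sum_Ico_sub (fun n : ℕ => HH n) hN]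
    apply Finset.sum_le_sum
    intro n hn
    have hn' : M0 ≤ n := (le_max_left _ _).trans (Finset.mem_Ico.1 hn).1
    have := hM0 n hn'
    exact HH_step ((le_max_left _ _).trans this) ((le_max_right _ _).trans this)
  have h2 := hs N
  rw [← Finset.sum_Ico_consecutive _ (le_max_right M0 2) hN] at h2
  have a1 := le_abs_self (HH M)
  have a1' := neg_abs_le (HH M)
  have a2 := neg_abs_le B
  linarith

lemma sum_upper (N : ℕ) (hN : 2 ≤ N) :
    ∑ n ∈ Finset.Ico 2 N, Λ n / Real.log n ≤
      (Nat.primeCounting' N : ℝ) + 4 * √N * Real.log N := by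
  rw [← Finset.sum_filter_add_sum_filter_not _ Nat.Prime]
  have h1 : ∑ n ∈ Finset.Ico 2 N with n.Prime, Λ n / Real.log n = (Nat.primeCounting' N : ℝ) := by
    rw [← Nat.primesBelow_card_eq_primeCounting', Nat.primesBelow_eq_filter_Ico_two,
      Finset.card_eq_sum_ones]
    push_cast
    apply Finset.sum_congr rfl
    intro n hn
    have hp := (Finset.mem_filter.1 hn).2
    rw [ArithmeticFunction.vonMangoldt_apply_prime hp]
    have := log_nat_ge hp.two_le
    exact div_self (by linarith)
  have h2 : ∑ n ∈ Finset.Ico 2 N with ¬ n.Prime, Λ n / Real.log n ≤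
      ∑ n ∈ Finset.Ioc 0 ⌊(N : ℝ)⌋₊ with ¬ n.Prime, 2 * Λ n := by
    rw [Nat.floor_natCast]
    calc _ ≤ ∑ n ∈ Finset.Ico 2 N with ¬ n.Prime, 2 * Λ n := by
          apply Finset.sum_le_sum
          intro n hn
          have hn2 := (Finset.mem_Ico.1 (Finset.mem_filter.1 hn).1).1
          have hL := log_nat_ge hn2
          have h0 : 0 ≤ Λ n := ArithmeticFunction.vonMangoldt_nonneg
          rw [div_le_iff₀ (by linarith)]
          nlinarith
      _ ≤ _ := by
          apply Finset.sum_le_sum_of_subset_of_nonneg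
          · intro n hn
            simp only [Finset.mem_filter, Finset.mem_Ico, Finset.mem_Ioc] at hn ⊢
            exact ⟨⟨by omega, by omega⟩, hn.2⟩
          · intro n _ _
            have h0 : 0 ≤ Λ n := ArithmeticFunction.vonMangoldt_nonneg
            linarith
  rw [← Finset.mul_sum, ← Chebyshev.psi_sub_theta_eq_sum_not_prime] at h2
  have h3 := Chebyshev.psi_sub_theta_le (x := (N : ℝ)) (by exact_mod_cast (by omega : 1 ≤ N))
  rw [h1]
  linarith

lemma pi_lower : ∀ᶠ N : ℕ in atTop,
    (N : ℝ) / Real.log N + N / Real.log N ^ 2 + N / (2 * Real.log N ^ 3) ≤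
      (Nat.primeCounting' N : ℝ) := by
  obtain ⟨K, M, hK, h⟩ := sum_lower
  have l8 : ∀ᶠ N : ℕ in atTop, Real.log N ^ 8 ≤ 1 / 400 * (N : ℝ) := by
    have := (isLittleO_pow_log_id_atTop (n := 8)).bound (by norm_num : (0:ℝ) < 1 / 400)
    filter_upwards [tendsto_natCast_atTop_atTop.eventually this] with N hN
    simpa using (le_abs_self _).trans hN
  have l3 : ∀ᶠ N : ℕ in atTop, Real.log N ^ 3 ≤ 1 / (20 * K) * (N : ℝ) := by
    have := (isLittleO_pow_log_id_atTop (n := 3)).bound (by positivity : (0:ℝ) < 1 / (20 * K))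
    filter_upwards [tendsto_natCast_atTop_atTop.eventually this] with N hN
    simpa using (le_abs_self _).trans hN
  filter_upwards [l8, l3, eventually_ge_atTop M, eventually_ge_atTop 2] with N h8 h3 hM h2
  have b1 := h N hM
  have b2 := sum_upper N h2
  have hL := log_nat_ge h2
  have hN0 : (0 : ℝ) < N := by exact_mod_cast (by omega : 0 < N)
  unfold HH at b1
  set L := Real.log N
  have hL0 : 0 < L := by linarith
  have hsq : √(N : ℝ) * √(N : ℝ) = N := Real.mul_self_sqrt hN0.le
  have hs0 : 0 ≤ √(N : ℝ) := Real.sqrt_nonneg _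
  have e4 : L ^ 4 ≤ √(N : ℝ) / 20 := by
    refine (pow_le_pow_iff_left₀ (by positivity) (by positivity) two_ne_zero).1 ?_
    calc (L ^ 4) ^ 2 = L ^ 8 := by ring
      _ ≤ 1 / 400 * (N : ℝ) := h8
      _ = (√(N : ℝ) * √(N : ℝ)) / 400 := by rw [hsq]; ring
      _ = _ := by ring
  have e3 : 2 * K * L ^ 3 ≤ N / 10 := by
    calc 2 * K * L ^ 3 ≤ 2 * K * (1 / (20 * K) * (N : ℝ)) :=
          mul_le_mul_of_nonneg_left h3 (by positivity)
      _ = N / 10 := by field_simp; norm_num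
  have key : K + 4 * √(N:ℝ) * L ≤ N / (2 * L ^ 3) := by
    rw [le_div_iff₀ (by positivity)]
    have : √(N:ℝ) * L ^ 4 ≤ √(N:ℝ) * (√(N:ℝ) / 20) := mul_le_mul_of_nonneg_left e4 hs0
    nlinarith
  have hhalf : (N : ℝ) / L ^ 3 = N / (2 * L ^ 3) + N / (2 * L ^ 3) := by field_simp; norm_num
  linarith

end Part6

theorem stmt_18
    (h : ∀ᶠ n : ℕ in atTop,
      (p n : ℝ) ^ ((1 : ℝ) / n) > (p (n + 1) : ℝ) ^ ((1 : ℝ) / (n + 1)) ∧ 0 ≤ a n) :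
    ∀ᶠ n : ℕ in atTop,
      (p (n + 1) : ℝ) - p n < (Real.log (p n)) ^ 2 - Real.log (p n) + 1 := by
  have hpt : Tendsto p atTop atTop := by
    apply tendsto_atTop_mono (f := fun n => n) _ tendsto_id
    intro n
    have := Nat.add_two_le_nth_prime (n - 1)
    unfold p
    omega
  have l4 : ∀ᶠ N : ℕ in atTop, Real.log N ^ 4 ≤ 1 / 3 * (N : ℝ) := by
    have := (isLittleO_pow_log_id_atTop (n := 4)).bound (by norm_num : (0:ℝ) < 1 / 3)
    filter_upwards [tendsto_natCast_atTop_atTop.eventually this] with N hN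
    simpa using (le_abs_self _).trans hN
  filter_upwards [h, hpt.eventually pi_lower, hpt.eventually l4, eventually_ge_atTop 1,
    hpt.eventually (eventually_ge_atTop 2)] with n hn hpi h4 hn1 hp2
  obtain ⟨hn, -⟩ := hn
  have hpc : (Nat.primeCounting' (p n) : ℝ) ≤ n := by
    unfold p
    rw [Nat.primeCounting'_nth_eq]
    exact_mod_cast Nat.sub_le n 1
  have hL := log_nat_ge hp2
  have hP0 : (0 : ℝ) < p n := by exact_mod_cast (by omega : 0 < p n)
  have hQ0 : (0 : ℝ) < p (n + 1) := by
    have := (Nat.prime_nth_prime (n + 1 - 1)).pos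
    unfold p; exact_mod_cast this
  have hnpos : (0 : ℝ) < n := by exact_mod_cast hn1
  have hlog : Real.log (p (n + 1)) < (n + 1) / n * Real.log (p n) := by
    have := Real.log_lt_log (by positivity) hn
    rw [Real.log_rpow hQ0, Real.log_rpow hP0] at this
    have h2 : (n + 1) * (1 / ((n : ℝ) + 1) * Real.log (p (n + 1))) <
        (n + 1) * (1 / (n : ℝ) * Real.log (p n)) :=
      mul_lt_mul_of_pos_left this (by positivity)
    have e1 : (n + 1) * (1 / ((n : ℝ) + 1) * Real.log (p (n + 1))) = Real.log (p (n + 1)) := by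
      field_simp
    rw [e1] at h2
    calc _ < _ := h2
      _ = _ := by ring
  set L := Real.log (p n) with hLdef
  set P : ℝ := (p n : ℝ) with hP
  set R : ℝ := (p (n + 1) : ℝ) with hR
  have hL0 : 0 < L := by linarith
  have hlt : R < P * Real.exp (L / n) := by
    rw [← Real.exp_log hQ0]
    calc Real.exp (Real.log R) < Real.exp ((n + 1) / n * L) := Real.exp_lt_exp.2 hlog
      _ = Real.exp (L + L / n) := by congr 1; field_simp
      _ = P * Real.exp (L / n) := by rw [Real.exp_add, hLdef, Real.exp_log hP0]
  set D : ℝ := L ^ 2 + L + 1 / 2 with hD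
  have hD0 : 0 < D := by positivity
  have hnlow : P * D / L ^ 3 ≤ n := by
    refine le_trans (le_of_eq ?_) (hpi.trans hpc)
    rw [hD]; field_simp
  -- t = L / n
  set t : ℝ := L / n with ht
  have ht0 : 0 < t := by positivity
  have htb : P * t ≤ L ^ 4 / D := by
    rw [ht, ← mul_div_assoc, div_le_div_iff₀ hnpos hD0]
    have : P * D ≤ n * L ^ 3 := by rwa [div_le_iff₀ (by positivity)] at hnlow
    nlinarith
  have hDeq : L ^ 4 / D < L ^ 2 - L + 1 / 2 := by
    rw [div_lt_iff₀ hD0, hD]; nlinarith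
  have hDL : L ^ 2 ≤ D := by rw [hD]; nlinarith
  have hPt : P * t ≤ L ^ 2 := by
    refine htb.trans ?_
    rw [div_le_iff₀ hD0]
    nlinarith [mul_le_mul_of_nonneg_left hDL (sq_nonneg L)]
  have hPt2 : P * t ^ 2 ≤ 1 / 3 := by
    have h1 : (P * t) ^ 2 ≤ (L ^ 2) ^ 2 := pow_le_pow_left₀ (by positivity) hPt 2
    have h2 : P * (P * t ^ 2) ≤ P * (1 / 3) := by
      calc P * (P * t ^ 2) = (P * t) ^ 2 := by ring
        _ ≤ L ^ 4 := by rw [← pow_mul] at h1; exact h1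
        _ ≤ 1 / 3 * P := h4
        _ = _ := by ring
    exact le_of_mul_le_mul_left h2 hP0
  have ht1 : t ≤ 1 := by
    have : 2 ≤ P := by rw [hP]; exact_mod_cast hp2
    nlinarith
  have hexp : Real.exp t - 1 - t ≤ t ^ 2 := by
    have := Real.abs_exp_sub_one_sub_id_le (x := t) (by rw [abs_of_pos ht0]; exact ht1)
    exact (le_abs_self _).trans this
  have : P * Real.exp t ≤ P * (1 + t + t ^ 2) := mul_le_mul_of_nonneg_left (by linarith) hP0.le
  nlinarith
end
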